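/- Under the stated assumptions, the Chen–Ledoux type condition holds: limsup_n b_n^{−2} log( |G_n| · ess sup_{i∈G_{n−p_n}} P(|Δ_{n,i}(𝔣_n)| > b_n | F_i) ) = −∞, where the essential supremum is over i ∈ G_{n−p_n} and over the conditional probability given F_i. -/

import Mathlib

open MeasureTheory Filter ProbabilityTheory

noncomputable section

namespace BMC

/-- A vertex of the infinite binary tree is a finite word over `{0,1}`. -/
abbrev Word : Type := List Bool

/-- The `k`-th generation `G_k` of the binary tree. -/
def gen (k : ℕ) : Finset Word :=
  (Finset.univ : Finset (Fin k → Bool)).image fun f => List.ofFn f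

/-- The tree `T_k` up to generation `k`. -/
def tree (k : ℕ) : Finset Word := (Finset.range (k + 1)).biUnion gen

/-- The (lexicographic-genealogic) order on the binary tree: `i ≤ j` iff `i` is an
ancestor of `j`, or `v0` is an ancestor of `i` and `v1` an ancestor of `j` for some `v`. -/
def wle (i j : Word) : Prop :=
  i <+: j ∨ ∃ v : Word, (v ++ [false]) <+: i ∧ (v ++ [true]) <+: j

variable {d : ℕ}

/-- Euclidean norm on `Fin d → ℝ`. -/
def enorm (x : Fin d → ℝ) : ℝ := Real.sqrt (∑ j, x j ^ 2)

/-- Action of the kernel `P` on a function of the pair of children. -/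
def Pop (P : Kernel (Fin d → ℝ) ((Fin d → ℝ) × (Fin d → ℝ)))
    (h : (Fin d → ℝ) × (Fin d → ℝ) → ℝ) (x : Fin d → ℝ) : ℝ := ∫ p, h p ∂(P x)

/-- The mean kernel `Q = (P₀ + P₁)/2`, acting on functions. -/
def Qop (P : Kernel (Fin d → ℝ) ((Fin d → ℝ) × (Fin d → ℝ)))
    (f : (Fin d → ℝ) → ℝ) : (Fin d → ℝ) → ℝ :=
  fun x => (∫ p, (f p.1 + f p.2) ∂(P x)) / 2

/-- The σ-field generated by the chain up to generation `k`. -/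
def sigmaUpTo {Ω : Type*} [MeasurableSpace Ω] (X : Word → Ω → (Fin d → ℝ)) (k : ℕ) :
    MeasurableSpace Ω :=
  ⨆ j ∈ tree k, MeasurableSpace.comap (X j) inferInstance

/-- The σ-field `F_i` generated by `X_u` for `u ≤ i` in the tree order. -/
def Fsig {Ω : Type*} [MeasurableSpace Ω] (X : Word → Ω → (Fin d → ℝ)) (i : Word) :
    MeasurableSpace Ω :=
  ⨆ u ∈ {u : Word | wle u i}, MeasurableSpace.comap (X u) inferInstance

/-- `X` is a bifurcating Markov chain with initial distribution `ν` and kernel `P`. -/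
structure IsBMC {Ω : Type*} [MeasurableSpace Ω] (Pr : Measure Ω)
    (X : Word → Ω → (Fin d → ℝ)) (ν : Measure (Fin d → ℝ))
    (P : Kernel (Fin d → ℝ) ((Fin d → ℝ) × (Fin d → ℝ))) : Prop where
  meas : ∀ i, Measurable (X i)
  init : Pr.map (X []) = ν
  branching : ∀ (k : ℕ) (g : Word → (Fin d → ℝ) → (Fin d → ℝ) → (Fin d → ℝ) → ℝ),
    (∀ i, Measurable fun p : (Fin d → ℝ) × (Fin d → ℝ) × (Fin d → ℝ) => g i p.1 p.2.1 p.2.2) →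
    (∀ i, ∃ C, ∀ x y z, |g i x y z| ≤ C) →
    (Pr[(fun ω => ∏ i ∈ gen k, g i (X i ω) (X (i ++ [false]) ω) (X (i ++ [true]) ω))
        | sigmaUpTo X k]
      =ᵐ[Pr] fun ω => ∏ i ∈ gen k, ∫ p, g i (X i ω) p.1 p.2 ∂(P (X i ω)))

/-- Uniform geometric ergodicity of `Q` with invariant measure `μm`, rate `α`, constant `M`. -/
def ErgodicQ (P : Kernel (Fin d → ℝ) ((Fin d → ℝ) × (Fin d → ℝ)))
    (μm : Measure (Fin d → ℝ)) (M α : ℝ) : Prop :=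
  ∀ (f : (Fin d → ℝ) → ℝ) (C : ℝ), Measurable f → (∀ x, |f x| ≤ C) →
    ∀ (n : ℕ) (x : Fin d → ℝ), |(Qop P)^[n] f x - ∫ y, f y ∂μm| ≤ M * α ^ n * C

/-- `μm` is invariant for `Q`. -/
def IsInvariantQ (P : Kernel (Fin d → ℝ) ((Fin d → ℝ) × (Fin d → ℝ)))
    (μm : Measure (Fin d → ℝ)) : Prop :=
  ∀ f : (Fin d → ℝ) → ℝ, Measurable f → (∃ C, ∀ x, |f x| ≤ C) →
    ∫ x, Qop P f x ∂μm = ∫ x, f x ∂μm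

/-- The bandwidth `h_n = 2^{-nγ}`. -/
def bandwidth (γ : ℝ) (n : ℕ) : ℝ := (2 : ℝ) ^ (-(n : ℝ) * γ)

/-- The kernel density estimator `μ̂_{A}(x)` built from observations indexed by `A`. -/
def est {Ω : Type*} (K : (Fin d → ℝ) → ℝ) (X : Word → Ω → (Fin d → ℝ)) (γ : ℝ)
    (A : Finset Word) (n : ℕ) (x : Fin d → ℝ) (ω : Ω) : ℝ :=
  (A.card : ℝ)⁻¹ * (bandwidth γ n ^ (d : ℝ))⁻¹ *
    ∑ u ∈ A, K ((bandwidth γ n)⁻¹ • (x - X u ω))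

/-- One-dimensional `k`-th partial derivative of `f` in direction `j` at `x`. -/
def pder (f : (Fin d → ℝ) → ℝ) (j : Fin d) (k : ℕ) (x : Fin d → ℝ) : ℝ :=
  iteratedDeriv k (fun t => f (Function.update x j t)) (x j)

/-- `f` belongs to the isotropic Hölder class of order `s` with constant `L`. -/
def HolderClass (f : (Fin d → ℝ) → ℝ) (s L : ℝ) : Prop :=
  (∀ (j : Fin d) (x : Fin d → ℝ),
      ContDiff ℝ (⌊s⌋₊ : ℕ∞) fun t => f (Function.update x j t)) ∧
  ∀ (j : Fin d) (x : Fin d → ℝ) (t : ℝ),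
    |pder f j ⌊s⌋₊ (Function.update x j t) - pder f j ⌊s⌋₊ x| ≤
      L * |x j - t| ^ (s - (⌊s⌋₊ : ℝ))

/-- Regularity of the kernel function `K`. -/
def KernelReg (K : (Fin d → ℝ) → ℝ) : Prop :=
  Measurable K ∧ (∃ C, ∀ x, |K x| ≤ C) ∧ Integrable K volume ∧
    Integrable (fun x => K x ^ 2) volume ∧ (∫ x, K x) = 1 ∧
    ∀ ε > 0, ∃ R, ∀ x, R ≤ enorm x → |enorm x * K x| < ε

/-- `K` is of order `⌊s⌋`. -/
def KernelOrder (K : (Fin d → ℝ) → ℝ) (s : ℝ) : Prop :=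
  Integrable (fun x => enorm x ^ s * |K x|) volume ∧
    ∀ (j : Fin d) (k : ℕ), 1 ≤ k → k ≤ ⌊s⌋₊ →
      ∀ x : Fin d → ℝ, (∫ t : ℝ, t ^ k * K (Function.update x j t)) = 0

/-- Conditions (2.7) on the moderate deviation speed `b_n`. -/
def SpeedCond (b : ℕ → ℝ) (γ s : ℝ) (d : ℕ) : Prop :=
  (∀ n, 0 < b n) ∧ Tendsto b atTop atTop ∧
    Tendsto (fun n : ℕ => (n : ℝ) ^ (3 / 2 : ℝ) * b n /
      Real.sqrt (2 ^ n * bandwidth γ n ^ (d : ℝ))) atTop (nhds 0) ∧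
    Tendsto (fun n => b n /
      Real.sqrt (2 ^ n * bandwidth γ n ^ (2 * s + d))) atTop atTop

/-- `W` satisfies a moderate deviation principle with speed `b_n²` and rate function `I`. -/
def MDPseq {E Ω : Type*} [TopologicalSpace E] [MeasurableSpace E] [MeasurableSpace Ω]
    (Pr : Measure Ω) (W : ℕ → Ω → E) (b : ℕ → ℝ) (I : E → ℝ) : Prop :=
  ∀ A : Set E, MeasurableSet A →
    (-(⨅ y ∈ interior A, (I y : EReal)) ≤
      Filter.liminf
        (fun n => (((b n ^ 2)⁻¹ : ℝ) : EReal) * ENNReal.log (Pr {ω | W n ω ∈ A})) atTop) ∧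
    Filter.limsup
        (fun n => (((b n ^ 2)⁻¹ : ℝ) : EReal) * ENNReal.log (Pr {ω | W n ω ∈ A})) atTop ≤
      -(⨅ y ∈ closure A, (I y : EReal))

/-- `f` centered with respect to `μm`. -/
def tilde (μm : Measure (Fin d → ℝ)) (f : (Fin d → ℝ) → ℝ) (x : Fin d → ℝ) : ℝ :=
  f x - ∫ y, f y ∂μm

/-- `M_A(f) = Σ_{i ∈ A} f(X_i)`. -/
def MA {Ω : Type*} (X : Word → Ω → (Fin d → ℝ)) (A : Finset Word)
    (f : (Fin d → ℝ) → ℝ) (ω : Ω) : ℝ :=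
  ∑ i ∈ A, f (X i ω)

/-- Assumption 2.4 on the sequence of functions `𝔣_n = (f_{ℓ,n})`, where `f n ℓ = f_{ℓ,n}`. -/
def FnAssump (P : Kernel (Fin d → ℝ) ((Fin d → ℝ) × (Fin d → ℝ)))
    (μm : Measure (Fin d → ℝ)) (γ : ℝ) (f : ℕ → ℕ → (Fin d → ℝ) → ℝ) (σ2 : ℝ) : Prop :=
  (∀ n ℓ, Measurable (f n ℓ)) ∧
  (∀ n ℓ, n < ℓ → f n ℓ = 0) ∧
  (∃ C : ℝ, ∀ n : ℕ, ∀ ℓ ≤ n,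
    (∀ x, bandwidth γ n ^ ((d : ℝ) / 2) * |f n ℓ x| ≤ C) ∧
    (∀ x, |Qop P (f n ℓ) x| ≤ C * bandwidth γ n ^ ((d : ℝ) / 2)) ∧
    (∀ x, |Qop P (fun y => f n ℓ y ^ 2) x| ≤ C) ∧
    (∀ x, |Pop P (fun q => f n ℓ q.1 * f n ℓ q.2) x| ≤ C * bandwidth γ n ^ (d : ℝ))) ∧
  (∃ C : ℝ, ∀ n : ℕ, ∀ ℓ ≤ n,
    (∫ x, |f n ℓ x| ∂μm) ≤ C * bandwidth γ n ^ ((d : ℝ) / 2) ∧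
    (∫ x, f n ℓ x ^ 2 ∂μm) ≤ C) ∧
  Tendsto (fun n => ∑ ℓ ∈ Finset.range (n + 1), ((2 : ℝ)⁻¹) ^ ℓ * ∫ x, f n ℓ x ^ 2 ∂μm)
    atTop (nhds σ2)

/-- `N_{n,∅}(𝔣_n)`. -/
def Nempty {Ω : Type*} (X : Word → Ω → (Fin d → ℝ)) (μm : Measure (Fin d → ℝ))
    (f : ℕ → ℕ → (Fin d → ℝ) → ℝ) (n : ℕ) (ω : Ω) : ℝ :=
  (Real.sqrt (2 ^ n))⁻¹ * ∑ ℓ ∈ Finset.range (n + 1), MA X (gen (n - ℓ)) (tilde μm (f n ℓ)) ω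

/-- Conditions on the auxiliary sequence `p_n`. -/
def PCond (p : ℕ → ℕ) (b : ℕ → ℝ) : Prop :=
  Monotone p ∧ (∀ n, 1 ≤ p n) ∧ (∀ n, 1 ≤ n → p n ≤ n) ∧
    Tendsto (fun n => (p n : ℝ) ^ 3 * b n ^ 2 / 2 ^ (n - p n : ℕ)) atTop (nhds 0)

/-- `N_{n,i}(𝔣_n)` for `i ∈ G_{n-p_n}`. -/
def Nni {Ω : Type*} (X : Word → Ω → (Fin d → ℝ)) (μm : Measure (Fin d → ℝ))
    (f : ℕ → ℕ → (Fin d → ℝ) → ℝ) (p : ℕ → ℕ) (n : ℕ) (i : Word) (ω : Ω) : ℝ :=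
  (Real.sqrt (2 ^ n))⁻¹ * ∑ ℓ ∈ Finset.range (p n + 1),
    ∑ j ∈ gen (p n - ℓ), tilde μm (f n ℓ) (X (i ++ j) ω)

/-- The martingale increment `Δ_{n,i}(𝔣_n)`. -/
def Dni {Ω : Type*} [MeasurableSpace Ω] (Pr : Measure Ω) (X : Word → Ω → (Fin d → ℝ))
    (μm : Measure (Fin d → ℝ)) (f : ℕ → ℕ → (Fin d → ℝ) → ℝ) (p : ℕ → ℕ)
    (n : ℕ) (i : Word) (ω : Ω) : ℝ :=
  Nni X μm f p n i ω - (Pr[Nni X μm f p n i | Fsig X i]) ω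

/-- Bounded measurable real functions. -/
def BddMeas {α : Type*} [MeasurableSpace α] (f : α → ℝ) : Prop :=
  Measurable f ∧ ∃ C, ∀ x, |f x| ≤ C

namespace BddMeas

variable {α β : Type*} [MeasurableSpace α] [MeasurableSpace β] {f g : α → ℝ}

theorem const (c : ℝ) : BddMeas fun _ : α => c := ⟨measurable_const, |c|, fun _ => le_rfl⟩

theorem mul (hf : BddMeas f) (hg : BddMeas g) : BddMeas fun x => f x * g x := by
  obtain ⟨hf, C, hC⟩ := hf
  obtain ⟨hg, D, hD⟩ := hg
  refine ⟨hf.mul hg, C * D, fun x => ?_⟩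
  rw [abs_mul]
  exact mul_le_mul (hC x) (hD x) (abs_nonneg _) ((abs_nonneg _).trans (hC x))

theorem add (hf : BddMeas f) (hg : BddMeas g) : BddMeas fun x => f x + g x := by
  obtain ⟨hf, C, hC⟩ := hf
  obtain ⟨hg, D, hD⟩ := hg
  exact ⟨hf.add hg, C + D, fun x => (abs_add_le _ _).trans (add_le_add (hC x) (hD x))⟩

theorem sub_const (hf : BddMeas f) (c : ℝ) : BddMeas fun x => f x - c := by
  simpa [sub_eq_add_neg] using hf.add (const (-c))

theorem const_mul (hf : BddMeas f) (c : ℝ) : BddMeas fun x => c * f x := (const c).mul hf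

theorem comp (hf : BddMeas f) {k : β → α} (hk : Measurable k) : BddMeas fun x => f (k x) :=
  ⟨hf.1.comp hk, hf.2.imp fun _ h x => h (k x)⟩

theorem sum {ι : Type*} (s : Finset ι) {F : ι → α → ℝ} (h : ∀ i ∈ s, BddMeas (F i)) :
    BddMeas fun x => ∑ i ∈ s, F i x := by
  classical
  induction s using Finset.induction_on with
  | empty => simpa using const 0
  | insert a s ha ih =>
    simp only [Finset.sum_insert ha]
    exact (h a (by simp)).add (ih fun i hi => h i (by simp [hi]))

theorem prod {ι : Type*} (s : Finset ι) {F : ι → α → ℝ} (h : ∀ i ∈ s, BddMeas (F i)) :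
    BddMeas fun x => ∏ i ∈ s, F i x := by
  classical
  induction s using Finset.induction_on with
  | empty => simpa using const 1
  | insert a s ha ih =>
    simp only [Finset.prod_insert ha]
    exact (h a (by simp)).mul (ih fun i hi => h i (by simp [hi]))

theorem exp (hf : BddMeas f) : BddMeas fun x => Real.exp (f x) := by
  obtain ⟨hf, C, hC⟩ := hf
  refine ⟨hf.exp, Real.exp C, fun x => ?_⟩
  rw [abs_of_pos (Real.exp_pos _)]
  exact Real.exp_le_exp.2 ((le_abs_self _).trans (hC x))

theorem integrable (hf : BddMeas f) (μ : Measure α) [IsFiniteMeasure μ] : Integrable f μ := by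
  obtain ⟨hf, C, hC⟩ := hf
  exact Integrable.of_bound hf.aestronglyMeasurable C (.of_forall hC)

theorem pop {P : Kernel (Fin d → ℝ) ((Fin d → ℝ) × (Fin d → ℝ))} [IsMarkovKernel P]
    {h : (Fin d → ℝ) × (Fin d → ℝ) → ℝ} (hh : BddMeas h) : BddMeas (Pop P h) := by
  obtain ⟨hm, C, hC⟩ := hh
  refine ⟨(hm.stronglyMeasurable.integral_kernel (κ := P)).measurable, C, fun x => ?_⟩
  have := norm_integral_le_of_norm_le_const (μ := P x) (f := h) (C := C) (.of_forall hC)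
  simpa [Pop] using this

theorem qop {P : Kernel (Fin d → ℝ) ((Fin d → ℝ) × (Fin d → ℝ))} [IsMarkovKernel P]
    {h : (Fin d → ℝ) → ℝ} (hh : BddMeas h) : BddMeas (Qop P h) := by
  have := (((hh.comp measurable_fst).add (hh.comp measurable_snd)).pop (P := P)).const_mul (1 / 2)
  convert this using 2
  simp only [Qop, Pop]
  ring

end BddMeas

theorem mem_gen {k : ℕ} {u : Word} : u ∈ gen k ↔ u.length = k := by
  simp only [gen, Finset.mem_image, Finset.mem_univ, true_and]
  constructor
  · rintro ⟨f, rfl⟩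
    simp
  · rintro rfl
    exact ⟨u.get, List.ofFn_get u⟩

theorem mem_tree {k : ℕ} {u : Word} : u ∈ tree k ↔ u.length ≤ k := by
  simp [tree, mem_gen]

theorem prod_tree_succ {N : ℕ} (F : Word → ℝ) :
    ∏ u ∈ tree (N + 1), F u =
      (∏ u ∈ tree N, F u) * ∏ u ∈ gen N, F (u ++ [false]) * F (u ++ [true]) := by
  classical
  have h1 : tree (N + 1) = tree N ∪ gen (N + 1) := by
    ext u
    simp only [Finset.mem_union, mem_tree, mem_gen]
    omega
  have h2 : gen (N + 1) = (gen N).image (· ++ [false]) ∪ (gen N).image (· ++ [true]) := by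
    ext u
    simp only [Finset.mem_union, Finset.mem_image, mem_gen]
    constructor
    · intro h
      obtain rfl | ⟨v, c, rfl⟩ := List.eq_nil_or_concat u
      · simp at h
      · simp only [List.concat_eq_append, List.length_append, List.length_singleton] at h ⊢
        cases c
        · exact Or.inl ⟨v, by omega, rfl⟩
        · exact Or.inr ⟨v, by omega, rfl⟩
    · rintro (⟨v, h, rfl⟩ | ⟨v, h, rfl⟩) <;> simp [h]
  rw [h1, Finset.prod_union, h2, Finset.prod_union, Finset.prod_image, Finset.prod_image,
    Finset.prod_mul_distrib]
  · intro a _ b _ h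
    simpa using h
  · intro a _ b _ h
    simpa using h
  · rw [Finset.disjoint_left]
    simp only [Finset.mem_image, not_exists, not_and]
    rintro _ ⟨v, _, rfl⟩ w _ h
    have := List.append_inj_right' h rfl
    simp at this
  · rw [Finset.disjoint_left]
    intro u
    simp only [mem_tree, mem_gen]
    omega

/-- Integrate out the last `r` generations of a product of functions of the vertices below `u`. -/
def collapse (P : Kernel (Fin d → ℝ) ((Fin d → ℝ) × (Fin d → ℝ)))
    (φ : Word → (Fin d → ℝ) → ℝ) : ℕ → Word → (Fin d → ℝ) → ℝ
  | 0, u => φ u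
  | r + 1, u => fun x => φ u x *
      Pop P (fun q => collapse P φ r (u ++ [false]) q.1 * collapse P φ r (u ++ [true]) q.2) x

section Tree

variable {P : Kernel (Fin d → ℝ) ((Fin d → ℝ) × (Fin d → ℝ))}

theorem collapse_succ_eq (φ : Word → (Fin d → ℝ) → ℝ) (N r : ℕ) (u : Word)
    (h : u.length + r = N) :
    collapse P φ (r + 1) u = collapse P (fun v => if v.length = N then fun x => φ v x *
      Pop P (fun q => φ (v ++ [false]) q.1 * φ (v ++ [true]) q.2) x else φ v) r u := by
  induction r generalizing u with
  | zero =>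
    simp only [add_zero] at h
    simp [collapse, h]
  | succ r ih =>
    rw [collapse, ih _ (by simp; omega), ih _ (by simp; omega)]
    conv_rhs => rw [collapse]
    rw [if_neg (by omega)]

theorem collapse_congr_of_not_below {φ φ' : Word → (Fin d → ℝ) → ℝ} {i : Word} {N : ℕ}
    (h : ∀ u, ¬ i <+: u → φ u = φ' u)
    (hi : collapse P φ (N - i.length) i = collapse P φ' (N - i.length) i) (r : ℕ) (u : Word)
    (hu : u.length + r = N) (hiu : ¬ i <+: u ∨ u = i) :
    collapse P φ r u = collapse P φ' r u := by
  induction r generalizing u with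
  | zero =>
    rcases hiu with hiu | rfl
    · exact h u hiu
    · simpa [show N - u.length = 0 by omega] using hi
  | succ r ih =>
    rcases hiu with hiu | rfl
    · have key : ∀ c : Bool, ¬ i <+: u ++ [c] ∨ u ++ [c] = i := by
        intro c
        by_cases hc : i <+: u ++ [c]
        · rcases List.prefix_concat_iff.1 (by simpa using hc) with hc | hc
          · exact Or.inr (by simpa using hc.symm)
          · exact absurd hc hiu
        · exact Or.inl hc
      rw [collapse, collapse, h u hiu, ih _ (by simp; omega) (key _), ih _ (by simp; omega) (key _)]
    · simpa [show N - u.length = r + 1 by omega] using hi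

theorem collapse_below {φ χ : Word → (Fin d → ℝ) → ℝ} {c w : ℕ → (Fin d → ℝ) → ℝ} {i : Word}
    {p : ℕ} (hφ : ∀ j x, φ (i ++ j) x = χ (i ++ j) x * c j.length x)
    (hχ : ∀ j, j ≠ [] → ∀ x, χ (i ++ j) x = 1)
    (hw : ∀ k x, w k x = c k x * Pop P (fun q => w (k + 1) q.1 * w (k + 1) q.2) x)
    (hwc : ∀ k, p ≤ k → w k = c k) (r : ℕ) (j : Word) (hj : p ≤ j.length + r) :
    collapse P φ r (i ++ j) = fun x => χ (i ++ j) x * w j.length x := by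
  induction r generalizing j with
  | zero =>
    funext x
    rw [collapse, hφ, hwc _ (by simpa using hj)]
  | succ r ih =>
    funext x
    have key : ∀ b : Bool, collapse P φ r (i ++ j ++ [b]) = w (j.length + 1) := by
      intro b
      rw [List.append_assoc, ih _ (by simp; omega)]
      funext y
      rw [hχ _ (by simp)]
      simp
    rw [collapse, key, key]
    dsimp only
    rw [hφ, hw, mul_assoc]

theorem prod_tree_below {Ω : Type*} {X : Word → Ω → (Fin d → ℝ)} {N p : ℕ}
    {i : Word} (hN : i.length + p ≤ N) (F : Word → ℝ)
    (c : ℕ → (Fin d → ℝ) → ℝ) (hc : ∀ k, p < k → c k = 1) (ω : Ω) :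
    (∏ u ∈ tree N, F u * if i <+: u then c (u.length - i.length) (X u ω) else 1) =
      (∏ u ∈ tree N, F u) * ∏ j ∈ tree p, c j.length (X (i ++ j) ω) := by
  classical
  rw [Finset.prod_mul_distrib]
  congr 1
  rw [← Finset.prod_subset (s₁ := (tree p).image (i ++ ·)), Finset.prod_image]
  · refine Finset.prod_congr rfl fun j _ => ?_
    rw [if_pos (List.prefix_append i j)]
    simp
  · intro a _ b _ h
    simpa using h
  · intro u hu
    obtain ⟨j, hj, rfl⟩ := Finset.mem_image.1 hu
    rw [mem_tree] at hj ⊢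
    simp
    omega
  · intro u _ hu
    split_ifs with h
    · obtain ⟨j, rfl⟩ := h
      have hj : p < j.length := by
        by_contra! hj
        exact hu (Finset.mem_image_of_mem _ (mem_tree.2 hj))
      simp [hc _ hj]
    · rfl

variable {Ω : Type*} [MeasurableSpace Ω] {Pr : Measure Ω} {X : Word → Ω → (Fin d → ℝ)}
  {ν : Measure (Fin d → ℝ)}

theorem sigmaUpTo_le (hX : ∀ i, Measurable (X i)) (k : ℕ) :
    sigmaUpTo X k ≤ ‹MeasurableSpace Ω› :=
  iSup₂_le fun j _ => (hX j).comap_le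

theorem Fsig_le (hX : ∀ i, Measurable (X i)) (i : Word) :
    Fsig X i ≤ ‹MeasurableSpace Ω› :=
  iSup₂_le fun j _ => (hX j).comap_le

theorem integral_prod_tree [IsProbabilityMeasure Pr] [IsMarkovKernel P] (h : IsBMC Pr X ν P)
    (N : ℕ) (φ : Word → (Fin d → ℝ) → ℝ) (hφ : ∀ u, BddMeas (φ u)) :
    ∫ ω, ∏ u ∈ tree N, φ u (X u ω) ∂Pr = ∫ ω, collapse P φ N [] (X [] ω) ∂Pr := by
  induction N generalizing φ with
  | zero =>
    have : tree 0 = {[]} := by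
      ext u
      simp [mem_tree]
    simp [this, collapse]
  | succ N ih =>
    have hpair : ∀ v, BddMeas fun q : (Fin d → ℝ) × (Fin d → ℝ) =>
        φ (v ++ [false]) q.1 * φ (v ++ [true]) q.2 := fun v =>
      ((hφ _).comp measurable_fst).mul ((hφ _).comp measurable_snd)
    rw [collapse_succ_eq φ N N [] (by simp), ← ih]
    swap
    · intro u
      split_ifs
      · exact (hφ u).mul (hpair u).pop
      · exact hφ u
    set A : Ω → ℝ := fun ω => ∏ u ∈ tree N, φ u (X u ω)
    set B : Ω → ℝ := fun ω => ∏ u ∈ gen N, φ (u ++ [false]) (X (u ++ [false]) ω) *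
      φ (u ++ [true]) (X (u ++ [true]) ω)
    set D : Ω → ℝ := fun ω => ∏ u ∈ gen N,
      Pop P (fun q => φ (u ++ [false]) q.1 * φ (u ++ [true]) q.2) (X u ω)
    have hBD : Pr[B | sigmaUpTo X N] =ᵐ[Pr] D :=
      h.branching N (fun u _ y z => φ (u ++ [false]) y * φ (u ++ [true]) z)
        (fun u => ((hpair u).comp measurable_snd).1)
        (fun u => by
          obtain ⟨-, C, hC⟩ := hpair u
          exact ⟨C, fun _ y z => hC (y, z)⟩)
    have hA : BddMeas A := .prod _ fun u _ => (hφ u).comp (h.meas u)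
    have hB : BddMeas B := .prod _ fun u _ =>
      ((hφ _).comp (h.meas _)).mul ((hφ _).comp (h.meas _))
    have hAm : StronglyMeasurable[sigmaUpTo X N] A := by
      refine Measurable.stronglyMeasurable ?_
      refine Finset.measurable_fun_prod _ fun u hu => (hφ u).1.comp ?_
      exact (comap_measurable (X u)).mono
        (le_iSup₂_of_le (f := fun j (_ : j ∈ tree N) => MeasurableSpace.comap (X j) inferInstance)
          u hu le_rfl) le_rfl
    have hle := sigmaUpTo_le h.meas N
    have e1 : (fun ω => ∏ u ∈ tree (N + 1), φ u (X u ω)) = A * B := by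
      funext ω
      exact prod_tree_succ fun u => φ u (X u ω)
    have e2 : (fun ω => ∏ u ∈ tree N, (if u.length = N then fun x => φ u x *
        Pop P (fun q => φ (u ++ [false]) q.1 * φ (u ++ [true]) q.2) x else φ u) (X u ω))
        = A * D := by
      funext ω
      have hsub : gen N ⊆ tree N := fun u hu => by
        rw [mem_gen] at hu
        rw [mem_tree, hu]
      have : D ω = ∏ u ∈ tree N, if u.length = N then
          Pop P (fun q => φ (u ++ [false]) q.1 * φ (u ++ [true]) q.2) (X u ω) else 1 := by
        rw [← Finset.prod_subset hsub]
        · exact Finset.prod_congr rfl fun u hu => by rw [if_pos (mem_gen.1 hu)]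
        · intro u _ hu
          rw [if_neg (by rwa [mem_gen] at hu)]
      rw [Pi.mul_apply, this, ← Finset.prod_mul_distrib]
      refine Finset.prod_congr rfl fun u _ => ?_
      split_ifs <;> simp
    rw [e1, e2, ← integral_condExp hle]
    refine integral_congr_ae ?_
    filter_upwards [condExp_mul_of_stronglyMeasurable_left hAm ((hA.mul hB).integrable Pr)
      (hB.integrable Pr), hBD] with ω h1 h2
    rw [h1, Pi.mul_apply, Pi.mul_apply, h2]

theorem integral_prod_mul_subtree [IsProbabilityMeasure Pr] [IsMarkovKernel P]
    (h : IsBMC Pr X ν P) {N p : ℕ} {i : Word} (hN : i.length + p ≤ N)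
    {χ : Word → (Fin d → ℝ) → ℝ} (hχb : ∀ u, BddMeas (χ u))
    (hχ : ∀ j, j ≠ [] → ∀ x, χ (i ++ j) x = 1)
    {c w : ℕ → (Fin d → ℝ) → ℝ} (hcb : ∀ k, BddMeas (c k)) (hwb : ∀ k, BddMeas (w k))
    (hw : ∀ k x, w k x = c k x * Pop P (fun q => w (k + 1) q.1 * w (k + 1) q.2) x)
    (hc1 : ∀ k, p < k → c k = 1) (hwc : ∀ k, p ≤ k → w k = c k) :
    ∫ ω, (∏ u ∈ tree N, χ u (X u ω)) * ∏ j ∈ tree p, c j.length (X (i ++ j) ω) ∂Pr =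
      ∫ ω, (∏ u ∈ tree N, χ u (X u ω)) * w 0 (X i ω) ∂Pr := by
  set c' : ℕ → (Fin d → ℝ) → ℝ := fun k => if k = 0 then w 0 else 1 with hc'
  have hc'b : ∀ k, BddMeas (c' k) := by
    intro k
    simp only [hc']
    split_ifs
    · exact hwb 0
    · exact .const 1
  have hφb : ∀ {e : ℕ → (Fin d → ℝ) → ℝ}, (∀ k, BddMeas (e k)) → ∀ u : Word,
      BddMeas fun x => χ u x * if i <+: u then e (u.length - i.length) x else 1 := by
    intro e he u
    split_ifs
    · exact (hχb u).mul (he _)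
    · exact (hχb u).mul (.const 1)
  have e1 : ∀ ω, (∏ u ∈ tree N, χ u (X u ω)) * ∏ j ∈ tree p, c j.length (X (i ++ j) ω) = _ :=
    fun ω => (prod_tree_below hN (fun u => χ u (X u ω)) c hc1 ω).symm
  have e2 : ∀ ω, (∏ u ∈ tree N, χ u (X u ω)) * w 0 (X i ω) =
      ∏ u ∈ tree N, χ u (X u ω) * if i <+: u then c' (u.length - i.length) (X u ω) else 1 := by
    intro ω
    rw [prod_tree_below (p := 0) (by omega) (fun u => χ u (X u ω)) c'
      (fun k hk => by simp [hc', hk.ne']) ω]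
    have : tree 0 = {[]} := by
      ext u
      simp [mem_tree]
    simp [this, hc']
  simp only [e1, e2]
  rw [integral_prod_tree h N
      (fun u x => χ u x * if i <+: u then c (u.length - i.length) x else 1) (hφb hcb),
    integral_prod_tree h N
      (fun u x => χ u x * if i <+: u then c' (u.length - i.length) x else 1) (hφb hc'b)]
  rw [collapse_congr_of_not_below (i := i) (N := N) _ _ N [] (by simp)]
  · by_cases hi : i = []
    · exact Or.inr hi.symm
    · exact Or.inl fun hp => hi (List.prefix_nil.1 hp)
  · intro u hu
    simp [hu]
  · have A := collapse_below (P := P) (χ := χ) (c := c) (w := w) (i := i) (p := p)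
      (φ := fun u x => χ u x * if i <+: u then c (u.length - i.length) x else 1)
      (by intro j x; simp) hχ hw hwc (N - i.length) [] (by simp; omega)
    have B := collapse_below (P := P) (χ := χ) (c := c') (w := c') (i := i) (p := 0)
      (φ := fun u x => χ u x * if i <+: u then c' (u.length - i.length) x else 1)
      (by intro j x; simp) hχ (by intro k x; simp [hc', Pop]) (fun _ _ => rfl)
      (N - i.length) [] (by simp)
    rw [List.append_nil] at A B
    rw [A, B]
    simp [hc']

theorem not_wle_append {i j : Word} (hj : j ≠ []) : ¬ wle (i ++ j) i := by
  rintro (h | ⟨v, h0, h1⟩)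
  · have h1 := h.length_le
    have h2 := List.length_pos_iff.2 hj
    rw [List.length_append] at h1
    omega
  · have h1' : v ++ [true] <+: i ++ j := h1.trans (List.prefix_append i j)
    have := List.prefix_of_prefix_length_le h0 h1' (by simp)
    simp at this

/-- Expected product of `ψ` over the remaining `r` generations of a subtree. -/
def subtreeVal (P : Kernel (Fin d → ℝ) ((Fin d → ℝ) × (Fin d → ℝ)))
    (ψ : ℕ → (Fin d → ℝ) → ℝ) : ℕ → (Fin d → ℝ) → ℝ
  | 0 => ψ 0
  | r + 1 => fun x => ψ (r + 1) x *
      Pop P (fun q => subtreeVal P ψ r q.1 * subtreeVal P ψ r q.2) x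

theorem BddMeas.subtreeVal [IsMarkovKernel P] {ψ : ℕ → (Fin d → ℝ) → ℝ}
    (hψ : ∀ k, BddMeas (ψ k)) (r : ℕ) : BddMeas (subtreeVal P ψ r) := by
  induction r with
  | zero => exact hψ 0
  | succ r ih => exact (hψ _).mul ((ih.comp measurable_fst).mul (ih.comp measurable_snd)).pop

theorem measurable_Fsig (i : Word) : Measurable[Fsig X i] (X i) :=
  (comap_measurable (X i)).mono
    (le_iSup₂_of_le (f := fun j (_ : j ∈ {u : Word | wle u i}) =>
      MeasurableSpace.comap (X j) inferInstance) i (Or.inl List.prefix_rfl) le_rfl) le_rfl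

theorem condExp_prod_subtree [IsProbabilityMeasure Pr] [IsMarkovKernel P]
    (h : IsBMC Pr X ν P) (p : ℕ) (i : Word) {ψ : ℕ → (Fin d → ℝ) → ℝ}
    (hψ : ∀ k, BddMeas (ψ k)) :
    Pr[fun ω => ∏ j ∈ tree p, ψ (p - j.length) (X (i ++ j) ω) | Fsig X i] =ᵐ[Pr]
      fun ω => subtreeVal P ψ p (X i ω) := by
  classical
  have hle := Fsig_le h.meas i
  have hH : BddMeas fun ω => ∏ j ∈ tree p, ψ (p - j.length) (X (i ++ j) ω) :=
    .prod _ fun j _ => (hψ _).comp (h.meas _)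
  have hU : BddMeas fun ω => subtreeVal P ψ p (X i ω) :=
    (BddMeas.subtreeVal hψ p).comp (h.meas i)
  have hHi := hH.integrable Pr
  have hUi := hU.integrable Pr
  set c : ℕ → (Fin d → ℝ) → ℝ := fun k => if k ≤ p then ψ (p - k) else 1 with hc
  set w : ℕ → (Fin d → ℝ) → ℝ := fun k => if k ≤ p then subtreeVal P ψ (p - k) else 1 with hw
  have hcb : ∀ k, BddMeas (c k) := by
    intro k
    simp only [hc]
    split_ifs
    · exact hψ _
    · exact .const 1
  have hwb : ∀ k, BddMeas (w k) := by
    intro k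
    simp only [hw]
    split_ifs
    · exact .subtreeVal hψ _
    · exact .const 1
  have hrec : ∀ k x, w k x = c k x * Pop P (fun q => w (k + 1) q.1 * w (k + 1) q.2) x := by
    intro k x
    simp only [hw, hc]
    rcases lt_trichotomy k p with hk | rfl | hk
    · rw [if_pos hk.le, if_pos hk.le, if_pos (by omega), show p - k = (p - (k + 1)) + 1 by omega,
        subtreeVal]
    · simp [subtreeVal, Pop]
    · rw [if_neg (by omega), if_neg (by omega), if_neg (by omega)]
      simp [Pop]
  have hwc : ∀ k, p ≤ k → w k = c k := by
    intro k hk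
    simp only [hw, hc]
    rcases hk.eq_or_lt with rfl | hk
    · simp [subtreeVal]
    · rw [if_neg (by omega), if_neg (by omega)]
  have hprod : ∀ ω, ∏ j ∈ tree p, ψ (p - j.length) (X (i ++ j) ω) =
      ∏ j ∈ tree p, c j.length (X (i ++ j) ω) := by
    intro ω
    refine Finset.prod_congr rfl fun j hj => ?_
    simp only [hc]
    rw [if_pos (mem_tree.1 hj)]
  have key : ∀ t : Finset Word, ↑t ⊆ {u : Word | wle u i} → ∀ f : Word → Set Ω,
      (∀ u ∈ t, MeasurableSet[MeasurableSpace.comap (X u) inferInstance] (f u)) →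
      ∫ ω in ⋂ u ∈ t, f u, subtreeVal P ψ p (X i ω) ∂Pr =
        ∫ ω in ⋂ u ∈ t, f u, ∏ j ∈ tree p, ψ (p - j.length) (X (i ++ j) ω) ∂Pr := by
    intro t ht f hf
    have hB : ∀ u, ∃ B : Set (Fin d → ℝ), MeasurableSet B ∧ (u ∈ t → X u ⁻¹' B = f u) := by
      intro u
      by_cases hu : u ∈ t
      · obtain ⟨B, hB, e⟩ := hf u hu
        exact ⟨B, hB, fun _ => e⟩
      · exact ⟨∅, .empty, fun h => absurd h hu⟩
    choose B hBm hBf using hB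
    set χ : Word → (Fin d → ℝ) → ℝ := fun u => if u ∈ t then (B u).indicator 1 else 1 with hχ
    have hχb : ∀ u, BddMeas (χ u) := by
      intro u
      simp only [hχ]
      split_ifs
      · refine ⟨measurable_one.indicator (hBm u), 1, fun x => ?_⟩
        by_cases hx : x ∈ B u <;> simp [hx]
      · exact .const 1
    obtain ⟨N, hN1, hN2⟩ : ∃ N, i.length + p ≤ N ∧ t ⊆ tree N := by
      refine ⟨max (i.length + p) (t.sup List.length), le_max_left _ _, fun u hu => ?_⟩
      rw [mem_tree]
      exact (Finset.le_sup (f := List.length) hu).trans (le_max_right _ _)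
    have hmeas : MeasurableSet (⋂ u ∈ t, f u) :=
      Finset.measurableSet_biInter _ fun u hu => (h.meas u).comap_le _ (hf u hu)
    have hind : ∀ ω, ∏ u ∈ tree N, χ u (X u ω) = (⋂ u ∈ t, f u).indicator 1 ω := by
      intro ω
      rw [← Finset.prod_subset hN2 (fun u _ hu => by simp [hχ, hu])]
      by_cases hω : ω ∈ ⋂ u ∈ t, f u
      · rw [Set.indicator_of_mem hω]
        refine Finset.prod_eq_one fun u hu => ?_
        have : X u ω ∈ B u := by
          have := Set.mem_iInter₂.1 hω u hu
          rwa [← hBf u hu] at this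
        simp [hχ, hu, this]
      · rw [Set.indicator_of_notMem hω]
        simp only [Set.mem_iInter, not_forall] at hω
        obtain ⟨u, hu, hω⟩ := hω
        refine Finset.prod_eq_zero hu ?_
        have : X u ω ∉ B u := by
          intro hx
          exact hω (by rw [← hBf u hu]; exact hx)
        simp [hχ, hu, this]
    have main := integral_prod_mul_subtree h hN1 hχb (fun j hj x => by
      have : i ++ j ∉ t := fun hm => not_wle_append hj (ht hm)
      simp [hχ, this]) hcb hwb hrec (fun k hk => by simp [hc, hk.not_ge]) hwc
    simp only [hind, ← hprod] at main
    rw [← integral_indicator hmeas, ← integral_indicator hmeas]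
    have hw0 : w 0 = subtreeVal P ψ p := by simp [hw]
    rw [hw0] at main
    convert main.symm using 2 <;>
    · funext ω
      by_cases hω : ω ∈ ⋂ u ∈ t, f u
      · rw [Set.indicator_of_mem hω, Set.indicator_of_mem hω, Pi.one_apply, one_mul]
      · rw [Set.indicator_of_notMem hω, Set.indicator_of_notMem hω, zero_mul]
  have huniv : ∫ ω, subtreeVal P ψ p (X i ω) ∂Pr =
      ∫ ω, ∏ j ∈ tree p, ψ (p - j.length) (X (i ++ j) ω) ∂Pr := by
    simpa using key ∅ (by simp) (fun _ => ∅) (by simp)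
  refine (ae_eq_condExp_of_forall_setIntegral_eq hle hHi
    (fun s _ _ => hUi.integrableOn) ?_ ?_).symm
  · intro s hs _
    refine MeasurableSpace.induction_on_inter (m := Fsig X i)
      (C := fun s _ => ∫ ω in s, subtreeVal P ψ p (X i ω) ∂Pr =
        ∫ ω in s, ∏ j ∈ tree p, ψ (p - j.length) (X (i ++ j) ω) ∂Pr)
      (generateFrom_piiUnionInter_measurableSet
        (fun u : Word => MeasurableSpace.comap (X u) inferInstance) {u : Word | wle u i}).symm
      (isPiSystem_piiUnionInter _ (fun u => @MeasurableSpace.isPiSystem_measurableSet _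
        (MeasurableSpace.comap (X u) inferInstance)) _) (by simp) ?_ ?_ ?_ s hs
    · rintro _ ⟨t, ht, f, hf, rfl⟩
      exact key t ht f hf
    · intro t htm ht
      have e1 := integral_add_compl (hle t htm) hHi
      have e2 := integral_add_compl (hle t htm) hUi
      linarith
    · intro f hd hfm hf
      rw [integral_iUnion (fun k => hle _ (hfm k)) hd hUi.integrableOn,
        integral_iUnion (fun k => hle _ (hfm k)) hd hHi.integrableOn]
      exact tsum_congr hf
  · exact (((BddMeas.subtreeVal hψ p).1.comp (measurable_Fsig i)).stronglyMeasurable).aestronglyMeasurable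

end Tree

/-- Expected sum over a subtree with `r` remaining generations, where `f ℓ` is evaluated `ℓ`
generations above the leaves. -/
def subtreeMean (P : Kernel (Fin d → ℝ) ((Fin d → ℝ) × (Fin d → ℝ)))
    (μm : Measure (Fin d → ℝ)) (f : ℕ → (Fin d → ℝ) → ℝ) (r : ℕ) (x : Fin d → ℝ) : ℝ :=
  ∑ ℓ ∈ Finset.range (r + 1), 2 ^ (r - ℓ) * ((Qop P)^[r - ℓ] (f ℓ) x - ∫ y, f ℓ y ∂μm)

theorem subtreeMean_zero (P : Kernel (Fin d → ℝ) ((Fin d → ℝ) × (Fin d → ℝ)))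
    (μm : Measure (Fin d → ℝ)) (f : ℕ → (Fin d → ℝ) → ℝ) :
    subtreeMean P μm f 0 = tilde μm (f 0) := by
  funext x
  simp [subtreeMean, tilde]

section Bounds

variable {P : Kernel (Fin d → ℝ) ((Fin d → ℝ) × (Fin d → ℝ))} [IsMarkovKernel P]

theorem Pop_exp_mul_exp_le {G : (Fin d → ℝ) → ℝ} (hG : Measurable G) {B t v : ℝ}
    (hB : ∀ x, |G x| ≤ B) (ht : |t| * (4 * B) ≤ 1) (x : Fin d → ℝ)
    (hv : Qop P (fun y => G y ^ 2) x ≤ v) :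
    Pop P (fun q => Real.exp (t * G q.1) * Real.exp (t * G q.2)) x ≤
      Real.exp (2 * t * Qop P G x + 4 * t ^ 2 * v) := by
  have hGb : BddMeas G := ⟨hG, B, hB⟩
  set a : (Fin d → ℝ) × (Fin d → ℝ) → ℝ := fun q => G q.1 + G q.2 with ha
  have hab : BddMeas a := (hGb.comp measurable_fst).add (hGb.comp measurable_snd)
  set e : ℝ := ∫ q, a q ∂(P x) with he
  have heQ : e = 2 * Qop P G x := by
    simp only [he, Qop, ha]
    ring
  have haB : ∀ q, |a q| ≤ 2 * B := fun q => by
    have := abs_add_le (G q.1) (G q.2)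
    have := hB q.1
    have := hB q.2
    simp only [ha]
    linarith
  have heB : |e| ≤ 2 * B := by
    have := norm_integral_le_of_norm_le_const (μ := P x) (f := a) (C := 2 * B) (.of_forall haB)
    simpa using this
  have hcb : BddMeas fun q => (a q - e) ^ 2 := by
    simpa [sq] using (hab.sub_const e).mul (hab.sub_const e)
  have hsqb : BddMeas fun y => G y ^ 2 := by simpa [sq] using hGb.mul hGb
  have hvar : ∫ q, (a q - e) ^ 2 ∂(P x) ≤ 4 * v := by
    have h1 : ∫ q, (a q - e) ^ 2 ∂(P x) ≤
        ∫ q, (2 * (G q.1 ^ 2 + G q.2 ^ 2) + (-2 * e * a q + e ^ 2)) ∂(P x) := by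
      refine integral_mono (hcb.integrable _) (BddMeas.integrable ?_ _) fun q => ?_
      · exact (((hsqb.comp measurable_fst).add (hsqb.comp measurable_snd)).const_mul 2).add
          ((hab.const_mul _).add (.const _))
      · simp only [ha]
        nlinarith [sq_nonneg (G q.1 - G q.2)]
    have h2 : ∫ q, (2 * (G q.1 ^ 2 + G q.2 ^ 2) + (-2 * e * a q + e ^ 2)) ∂(P x) =
        4 * Qop P (fun y => G y ^ 2) x - e ^ 2 := by
      rw [integral_add
          ((((hsqb.comp measurable_fst).add (hsqb.comp measurable_snd)).const_mul 2).integrable _)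
          (((hab.const_mul (-2 * e)).add (.const (e ^ 2))).integrable _), integral_const_mul,
        integral_add ((hab.const_mul (-2 * e)).integrable _) (integrable_const (e ^ 2)),
        integral_const_mul, ← he]
      simp only [Qop, integral_const, probReal_univ, smul_eq_mul]
      ring
    nlinarith [sq_nonneg e]
  have hpt : ∀ q, Real.exp (t * G q.1) * Real.exp (t * G q.2) ≤
      Real.exp (t * e) * (1 + t * (a q - e) + t ^ 2 * (a q - e) ^ 2) := by
    intro q
    have hs : |t * (a q - e)| ≤ 1 := by
      rw [abs_mul]
      refine le_trans (mul_le_mul_of_nonneg_left ?_ (abs_nonneg t)) ht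
      have := abs_sub (a q) e
      have := haB q
      linarith
    have h1 := (abs_le.1 (Real.abs_exp_sub_one_sub_id_le hs)).2
    rw [← Real.exp_add, show t * G q.1 + t * G q.2 = t * e + t * (a q - e) by simp only [ha]; ring,
      Real.exp_add]
    refine mul_le_mul_of_nonneg_left ?_ (Real.exp_pos _).le
    rw [mul_pow] at h1
    linarith
  have hint : Pop P (fun q => Real.exp (t * G q.1) * Real.exp (t * G q.2)) x ≤
      Real.exp (t * e) * (1 + t ^ 2 * ∫ q, (a q - e) ^ 2 ∂(P x)) := by
    have hL : BddMeas fun q : (Fin d → ℝ) × (Fin d → ℝ) =>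
        Real.exp (t * G q.1) * Real.exp (t * G q.2) :=
      ((hGb.const_mul t).exp.comp measurable_fst).mul ((hGb.const_mul t).exp.comp measurable_snd)
    have hR1 : BddMeas fun q => t * (a q - e) := (hab.sub_const e).const_mul t
    have hR2 : BddMeas fun q => 1 + t * (a q - e) := (BddMeas.const 1).add hR1
    have hR3 := hcb.const_mul (t ^ 2)
    refine (integral_mono (hL.integrable _) (((hR2.add hR3).const_mul _).integrable _)
      hpt).trans_eq ?_
    rw [integral_const_mul, integral_add (hR2.integrable _) (hR3.integrable _),
      integral_add (integrable_const _) (hR1.integrable _), integral_const_mul, integral_const_mul,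
      integral_sub (hab.integrable _) (integrable_const _)]
    simp [← he]
  refine hint.trans ?_
  rw [show 2 * t * Qop P G x + 4 * t ^ 2 * v = t * e + 4 * t ^ 2 * v by rw [heQ]; ring,
    Real.exp_add]
  refine mul_le_mul_of_nonneg_left ?_ (Real.exp_pos _).le
  have := Real.add_one_le_exp (4 * t ^ 2 * v)
  nlinarith [mul_le_mul_of_nonneg_left hvar (sq_nonneg t)]

theorem subtreeVal_exp_le {g F : ℕ → (Fin d → ℝ) → ℝ} (hg : ∀ k, BddMeas (g k))
    (hF : ∀ k, Measurable (F k)) (h0 : F 0 = g 0)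
    (hsucc : ∀ r x, F (r + 1) x = g (r + 1) x + 2 * Qop P (F r) x) {p : ℕ} {B C α t : ℝ}
    (hα : α < 1) (hB : ∀ r ≤ p, ∀ x, |F r x| ≤ B)
    (hC : ∀ r ≤ p, ∀ x, Qop P (fun y => F r y ^ 2) x ≤ C * (2 * α) ^ r)
    (ht : |t| * (4 * B) ≤ 1) (r : ℕ) (hr : r ≤ p) (x : Fin d → ℝ) :
    0 ≤ subtreeVal P (fun k y => Real.exp (t * g k y)) r x ∧
    subtreeVal P (fun k y => Real.exp (t * g k y)) r x ≤
      Real.exp (t * F r x + t ^ 2 * (2 * C / (1 - α) * 2 ^ r * (1 - α ^ r))) := by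
  induction r generalizing x with
  | zero => simp [subtreeVal, h0, Real.exp_nonneg]
  | succ r ih =>
    have ih' := ih (by omega)
    set W : ℝ := 2 * C / (1 - α) * 2 ^ r * (1 - α ^ r) with hW
    have hFb : BddMeas (F r) := ⟨hF r, B, hB r (by omega)⟩
    set U := subtreeVal P (fun k y => Real.exp (t * g k y)) r with hU
    have hUb : BddMeas U := BddMeas.subtreeVal (fun k => ((hg k).const_mul t).exp) r
    have hW' : 2 * C / (1 - α) * 2 ^ (r + 1) * (1 - α ^ (r + 1)) =
        2 * W + 4 * (C * (2 * α) ^ r) := by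
      have : 1 - α ≠ 0 := by linarith
      rw [hW, mul_pow]
      field_simp
      ring
    have hstep : Pop P (fun q => U q.1 * U q.2) x ≤
        Real.exp (2 * t ^ 2 * W) *
          Real.exp (2 * t * Qop P (F r) x + 4 * t ^ 2 * (C * (2 * α) ^ r)) := by
      refine le_trans ?_ (mul_le_mul_of_nonneg_left
        (Pop_exp_mul_exp_le (hF r) (hB r (by omega)) ht x (hC r (by omega) x))
        (Real.exp_pos _).le)
      rw [Pop, Pop, ← integral_const_mul]
      have hexp := (hFb.const_mul t).exp
      refine integral_mono (((hUb.comp measurable_fst).mul (hUb.comp measurable_snd)).integrable _)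
        ((((hexp.comp measurable_fst).mul (hexp.comp measurable_snd)).const_mul _).integrable _)
        fun q => ?_
      refine (mul_le_mul (ih' q.1).2 (ih' q.2).2 (ih' q.2).1 (Real.exp_pos _).le).trans_eq ?_
      rw [← Real.exp_add, ← Real.exp_add, ← Real.exp_add]
      ring_nf
    constructor
    · exact mul_nonneg (Real.exp_pos _).le
        (integral_nonneg fun q => mul_nonneg (ih' q.1).1 (ih' q.2).1)
    · rw [subtreeVal]
      refine (mul_le_mul_of_nonneg_left hstep (Real.exp_pos _).le).trans_eq ?_
      rw [hW', hsucc, ← Real.exp_add, ← Real.exp_add]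
      ring_nf

variable {μm : Measure (Fin d → ℝ)} {f : ℕ → (Fin d → ℝ) → ℝ}

theorem BddMeas.iterate_qop {g : (Fin d → ℝ) → ℝ} (hg : BddMeas g) (k : ℕ) :
    BddMeas ((Qop P)^[k] g) := by
  induction k with
  | zero => exact hg
  | succ k ih =>
    rw [Function.iterate_succ_apply']
    exact ih.qop

theorem BddMeas.subtreeMean (hf : ∀ k, BddMeas (f k)) (r : ℕ) :
    BddMeas (subtreeMean P μm f r) :=
  .sum _ fun ℓ _ => (((hf ℓ).iterate_qop _).sub_const _).const_mul _

theorem Qop_subtreeMean (hf : ∀ k, BddMeas (f k)) (r : ℕ) (x : Fin d → ℝ) :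
    Qop P (subtreeMean P μm f r) x = ∑ ℓ ∈ Finset.range (r + 1),
      2 ^ (r - ℓ) * ((Qop P)^[r - ℓ + 1] (f ℓ) x - ∫ y, f ℓ y ∂μm) := by
  have hb : ∀ ℓ, BddMeas fun y => 2 ^ (r - ℓ) * ((Qop P)^[r - ℓ] (f ℓ) y - ∫ y, f ℓ y ∂μm) :=
    fun ℓ => (((hf ℓ).iterate_qop _).sub_const _).const_mul _
  have hb' : ∀ ℓ, BddMeas fun q : (Fin d → ℝ) × (Fin d → ℝ) =>
      2 ^ (r - ℓ) * ((Qop P)^[r - ℓ] (f ℓ) q.1 - ∫ y, f ℓ y ∂μm) +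
      2 ^ (r - ℓ) * ((Qop P)^[r - ℓ] (f ℓ) q.2 - ∫ y, f ℓ y ∂μm) :=
    fun ℓ => ((hb ℓ).comp measurable_fst).add ((hb ℓ).comp measurable_snd)
  simp only [Qop, subtreeMean, ← Finset.sum_add_distrib]
  rw [integral_finsetSum _ fun ℓ _ => (hb' ℓ).integrable _, Finset.sum_div]
  refine Finset.sum_congr rfl fun ℓ _ => ?_
  have hi := (hf ℓ).iterate_qop (P := P) (r - ℓ)
  have hi2 := (hi.comp measurable_fst).add (hi.comp measurable_snd)
  rw [Function.iterate_succ_apply']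
  have : ∀ q : (Fin d → ℝ) × (Fin d → ℝ),
      2 ^ (r - ℓ) * ((Qop P)^[r - ℓ] (f ℓ) q.1 - ∫ y, f ℓ y ∂μm) +
      2 ^ (r - ℓ) * ((Qop P)^[r - ℓ] (f ℓ) q.2 - ∫ y, f ℓ y ∂μm) =
      2 ^ (r - ℓ) * (((Qop P)^[r - ℓ] (f ℓ) q.1 + (Qop P)^[r - ℓ] (f ℓ) q.2) -
        2 * ∫ y, f ℓ y ∂μm) := fun q => by ring
  change (∫ q, (2 ^ (r - ℓ) * ((Qop P)^[r - ℓ] (f ℓ) q.1 - ∫ y, f ℓ y ∂μm) +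
      2 ^ (r - ℓ) * ((Qop P)^[r - ℓ] (f ℓ) q.2 - ∫ y, f ℓ y ∂μm)) ∂(P x)) / 2 =
    2 ^ (r - ℓ) * (Qop P ((Qop P)^[r - ℓ] (f ℓ)) x - ∫ y, f ℓ y ∂μm)
  simp only [this]
  rw [integral_const_mul, integral_sub (hi2.integrable _) (integrable_const _)]
  simp only [Qop, integral_const, probReal_univ, smul_eq_mul]
  ring

theorem subtreeMean_succ (hf : ∀ k, BddMeas (f k)) (r : ℕ) (x : Fin d → ℝ) :
    subtreeMean P μm f (r + 1) x =
      tilde μm (f (r + 1)) x + 2 * Qop P (subtreeMean P μm f r) x := by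
  rw [Qop_subtreeMean hf, subtreeMean, Finset.sum_range_succ, Finset.mul_sum, add_comm]
  congr 1
  · simp [tilde]
  · refine Finset.sum_congr rfl fun ℓ hℓ => ?_
    have : ℓ < r + 1 := Finset.mem_range.1 hℓ
    rw [show r + 1 - ℓ = r - ℓ + 1 by omega, pow_succ]
    ring

theorem sum_pow_sub_le {a : ℝ} (ha : 1 < a) (r : ℕ) :
    ∑ ℓ ∈ Finset.range r, a ^ (r - ℓ) ≤ a / (a - 1) * a ^ r := by
  have h1 : a - 1 ≠ 0 := by linarith
  have key : ∑ ℓ ∈ Finset.range r, a ^ (r - ℓ) = a / (a - 1) * (a ^ r - 1) := by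
    induction r with
    | zero => simp
    | succ r ih =>
      have : ∑ ℓ ∈ Finset.range r, a ^ (r + 1 - ℓ) = a * ∑ ℓ ∈ Finset.range r, a ^ (r - ℓ) := by
        rw [Finset.mul_sum]
        refine Finset.sum_congr rfl fun ℓ hℓ => ?_
        have : ℓ < r := Finset.mem_range.1 hℓ
        rw [show r + 1 - ℓ = r - ℓ + 1 by omega, pow_succ]
        ring
      rw [Finset.sum_range_succ, this, ih]
      simp only [Nat.add_sub_cancel_left, pow_one]
      field_simp
      ring
  rw [key]
  have : 0 ≤ a / (a - 1) := div_nonneg (by linarith) (by linarith)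
  nlinarith

theorem subtreeMean_sub_le [IsProbabilityMeasure μm] (hinv : IsInvariantQ P μm) {M α : ℝ}
    (hM : 0 ≤ M) (hα : 1 / 2 < α) (herg : ErgodicQ P μm M α) (hf : ∀ k, BddMeas (f k))
    {D : ℝ} {r : ℕ} (hQ : ∀ ℓ ≤ r, ∀ x, |Qop P (f ℓ) x| ≤ D) (x : Fin d → ℝ) :
    |subtreeMean P μm f r x - tilde μm (f r) x| ≤
      2 * M * D / (2 * α - 1) * (2 * α) ^ r := by
  have hD : 0 ≤ D := (abs_nonneg _).trans (hQ 0 (by omega) x)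
  have e : subtreeMean P μm f r x - tilde μm (f r) x =
      ∑ ℓ ∈ Finset.range r, 2 ^ (r - ℓ) * ((Qop P)^[r - ℓ] (f ℓ) x - ∫ y, f ℓ y ∂μm) := by
    rw [subtreeMean, Finset.sum_range_succ]
    simp [tilde]
  have hterm : ∀ ℓ ∈ Finset.range r,
      |2 ^ (r - ℓ) * ((Qop P)^[r - ℓ] (f ℓ) x - ∫ y, f ℓ y ∂μm)| ≤
        M * D / α * (2 * α) ^ (r - ℓ) := by
    intro ℓ hℓ
    obtain ⟨k, hk⟩ : ∃ k, r - ℓ = k + 1 := ⟨r - ℓ - 1, by have := Finset.mem_range.1 hℓ; omega⟩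
    have h1 := herg (Qop P (f ℓ)) D (hf ℓ).qop.1
      (hQ ℓ (Finset.mem_range.1 hℓ).le) k x
    rw [hinv _ (hf ℓ).1 (hf ℓ).2] at h1
    rw [hk, abs_mul, abs_of_pos (by positivity : (0 : ℝ) < 2 ^ (k + 1)),
      Function.iterate_succ_apply]
    refine (mul_le_mul_of_nonneg_left h1 (by positivity)).trans_eq ?_
    have : α ≠ 0 := by linarith
    rw [mul_pow]
    field_simp
    ring
  rw [e]
  refine (Finset.abs_sum_le_sum_abs _ _).trans ((Finset.sum_le_sum hterm).trans ?_)
  rw [← Finset.mul_sum]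
  have hα0 : 0 < α := by linarith
  refine (mul_le_mul_of_nonneg_left (sum_pow_sub_le (a := 2 * α) (by linarith) r)
    (by positivity)).trans_eq ?_
  have : 2 * α - 1 ≠ 0 := by linarith
  field_simp

theorem subtreeMean_bounds [IsProbabilityMeasure μm] (hinv : IsInvariantQ P μm) {M α : ℝ}
    (hM : 0 ≤ M) (hα : 1 / 2 < α) (herg : ErgodicQ P μm M α) (hf : ∀ k, BddMeas (f k))
    {C η : ℝ} {p : ℕ} (hη0 : 0 < η) (hη1 : η ≤ 1) (hηα : (2 * α) ^ p * η ^ 2 ≤ 1)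
    (hsup : ∀ ℓ ≤ p, ∀ x, η * |f ℓ x| ≤ C)
    (hQ : ∀ ℓ ≤ p, ∀ x, |Qop P (f ℓ) x| ≤ C * η)
    (hQ2 : ∀ ℓ ≤ p, ∀ x, |Qop P (fun y => f ℓ y ^ 2) x| ≤ C)
    (hμ : ∀ ℓ ≤ p, ∫ x, |f ℓ x| ∂μm ≤ C * η) (r : ℕ) (hr : r ≤ p) :
    (∀ x, |subtreeMean P μm f r x| ≤ (2 * C + 2 * M * C / (2 * α - 1)) / η) ∧
    ∀ x, Qop P (fun y => subtreeMean P μm f r y ^ 2) x ≤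
      (4 * C + 4 * C ^ 2 + 2 * (2 * M * C / (2 * α - 1)) ^ 2) * (2 * α) ^ r := by
  have hC : 0 ≤ C := (mul_nonneg hη0.le (abs_nonneg _)).trans (hsup 0 (by omega) 0)
  set K : ℝ := 2 * M * C / (2 * α - 1) with hK
  have hK0 : 0 ≤ K := div_nonneg (by positivity) (by linarith)
  have h1 : 1 ≤ (2 * α) ^ r := one_le_pow₀ (by linarith)
  have hrη : (2 * α) ^ r * η ^ 2 ≤ 1 :=
    (mul_le_mul_of_nonneg_right (pow_le_pow_right₀ (by linarith) hr) (sq_nonneg _)).trans hηα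
  have hR : ∀ x, |subtreeMean P μm f r x - tilde μm (f r) x| ≤ K * η * (2 * α) ^ r := by
    intro x
    refine (subtreeMean_sub_le hinv hM hα herg hf (fun ℓ hℓ => hQ ℓ (hℓ.trans hr)) x).trans_eq ?_
    rw [hK]
    ring
  have hmean : |∫ y, f r y ∂μm| ≤ C * η := abs_integral_le_integral_abs.trans (hμ r hr)
  have hηinv : η ≤ 1 / η := by
    rw [le_div_iff₀ hη0]
    nlinarith
  constructor
  · intro x
    have h2 : |f r x| ≤ C * (1 / η) := by
      rw [mul_one_div, le_div_iff₀ hη0, mul_comm]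
      exact hsup r hr x
    have h3 : η * (2 * α) ^ r ≤ 1 / η := by
      rw [le_div_iff₀ hη0]
      linarith
    have h4 := hR x
    have h5 : |tilde μm (f r) x| ≤ |f r x| + |∫ y, f r y ∂μm| := abs_sub _ _
    have h6 : |subtreeMean P μm f r x| ≤ |subtreeMean P μm f r x - tilde μm (f r) x| +
        |tilde μm (f r) x| := by
      simpa using abs_add_le (subtreeMean P μm f r x - tilde μm (f r) x) (tilde μm (f r) x)
    rw [div_eq_mul_one_div]
    nlinarith [mul_le_mul_of_nonneg_left h3 hK0, mul_le_mul_of_nonneg_left hηinv hC]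
  · intro x
    have hpt : ∀ y, subtreeMean P μm f r y ^ 2 ≤
        4 * f r y ^ 2 + (4 * C ^ 2 + 2 * K ^ 2 * (2 * α) ^ r) := by
      intro y
      set R := subtreeMean P μm f r y - tilde μm (f r) y with hRdef
      have e : subtreeMean P μm f r y = f r y - (∫ z, f r z ∂μm) + R := by
        simp [hRdef, tilde]
      have hR2 : R ^ 2 ≤ K ^ 2 * (2 * α) ^ r := by
        have := pow_le_pow_left₀ (abs_nonneg R) (hR y) 2
        rw [sq_abs] at this
        refine this.trans ?_
        calc (K * η * (2 * α) ^ r) ^ 2 = K ^ 2 * (2 * α) ^ r * ((2 * α) ^ r * η ^ 2) := by ring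
          _ ≤ K ^ 2 * (2 * α) ^ r * 1 := mul_le_mul_of_nonneg_left hrη (by positivity)
          _ = _ := mul_one _
      have hm2 : (∫ z, f r z ∂μm) ^ 2 ≤ C ^ 2 := by
        have := pow_le_pow_left₀ (abs_nonneg _) (hmean.trans (mul_le_of_le_one_right hC hη1)) 2
        rwa [sq_abs] at this
      rw [e]
      nlinarith [sq_nonneg (f r y - (∫ z, f r z ∂μm) - R), sq_nonneg (f r y + ∫ z, f r z ∂μm)]
    have hFb : BddMeas fun y => subtreeMean P μm f r y ^ 2 := by
      simpa [sq] using (BddMeas.subtreeMean (P := P) (μm := μm) hf r).mul (.subtreeMean hf r)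
    have hfb : BddMeas fun y => f r y ^ 2 := by simpa [sq] using (hf r).mul (hf r)
    have hmono : Qop P (fun y => subtreeMean P μm f r y ^ 2) x ≤
        4 * Qop P (fun y => f r y ^ 2) x + (4 * C ^ 2 + 2 * K ^ 2 * (2 * α) ^ r) := by
      have hf2 := (hfb.comp measurable_fst).add (hfb.comp measurable_snd)
      have : ∫ q, (subtreeMean P μm f r q.1 ^ 2 + subtreeMean P μm f r q.2 ^ 2) ∂(P x) ≤
          ∫ q, (4 * (f r q.1 ^ 2 + f r q.2 ^ 2) +
            2 * (4 * C ^ 2 + 2 * K ^ 2 * (2 * α) ^ r)) ∂(P x) := by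
        refine integral_mono (((hFb.comp measurable_fst).add (hFb.comp measurable_snd)).integrable _)
          (((hf2.const_mul 4).add (.const _)).integrable _) fun q => ?_
        have := hpt q.1
        have := hpt q.2
        dsimp only
        linarith
      rw [integral_add ((hf2.const_mul 4).integrable _) (integrable_const _),
        integral_const_mul] at this
      simp only [integral_const, probReal_univ, smul_eq_mul, one_mul] at this
      simp only [Qop]
      linarith
    have h7 := (abs_le.1 (hQ2 r hr x)).2
    nlinarith [mul_le_mul_of_nonneg_left h1 hC, mul_le_mul_of_nonneg_left h1 (sq_nonneg C)]

end Bounds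

theorem condExp_deviation_le {Ω : Type*} {m mΩ : MeasurableSpace Ω} (hm : m ≤ mΩ)
    {Pr : Measure Ω} [IsProbabilityMeasure Pr] {Y Z : Ω → ℝ} (hY : BddMeas Y) (hZ : BddMeas Z)
    (hZm : Measurable[m] Z) {θ c b : ℝ} (hθ : 0 < θ)
    (h1 : Pr[fun ω => Real.exp (θ * Y ω) | m] ≤ᵐ[Pr] fun ω => Real.exp (Z ω + c))
    (h2 : Pr[fun ω => Real.exp (-θ * Y ω) | m] ≤ᵐ[Pr] fun ω => Real.exp (-Z ω + c)) :
    Pr[Set.indicator {ω | |Y ω - (Pr[Y | m]) ω| > b} (fun _ => (1 : ℝ)) | m] ≤ᵐ[Pr]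
      fun _ => 2 * Real.exp c * Real.exp (Real.exp c) * Real.exp (-(θ * b)) := by
  set V : Ω → ℝ := fun ω => θ * Y ω - Z ω with hV
  have hVb : BddMeas V := by
    simpa [hV, sub_eq_add_neg] using (hY.const_mul θ).add (hZ.const_mul (-1))
  have hVe := hVb.exp
  have hVe' : BddMeas fun ω => Real.exp (-V ω) := by
    simpa using (hVb.const_mul (-1)).exp
  have hE1 : Pr[fun ω => Real.exp (V ω) | m] ≤ᵐ[Pr] fun _ => Real.exp c := by
    have e : (fun ω => Real.exp (V ω)) =
        (fun ω => Real.exp (-Z ω)) * fun ω => Real.exp (θ * Y ω) := by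
      funext ω
      rw [Pi.mul_apply, ← Real.exp_add]
      simp only [hV]
      ring_nf
    have hi := hVe.integrable Pr
    rw [e] at hi ⊢
    have hn : Measurable[m] fun ω => Real.exp (-Z ω) := hZm.neg.exp
    filter_upwards [condExp_mul_of_stronglyMeasurable_left hn.stronglyMeasurable hi
      ((hY.const_mul θ).exp.integrable Pr), h1] with ω a1 a2
    rw [a1, Pi.mul_apply]
    refine (mul_le_mul_of_nonneg_left a2 (Real.exp_pos _).le).trans_eq ?_
    rw [← Real.exp_add]
    ring_nf
  have hE2 : Pr[fun ω => Real.exp (-V ω) | m] ≤ᵐ[Pr] fun _ => Real.exp c := by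
    have e : (fun ω => Real.exp (-V ω)) =
        (fun ω => Real.exp (Z ω)) * fun ω => Real.exp (-θ * Y ω) := by
      funext ω
      rw [Pi.mul_apply, ← Real.exp_add]
      simp only [hV]
      ring_nf
    have hi := hVe'.integrable Pr
    rw [e] at hi ⊢
    filter_upwards [condExp_mul_of_stronglyMeasurable_left (hZm.exp.stronglyMeasurable) hi
      ((hY.const_mul (-θ)).exp.integrable Pr), h2] with ω a1 a2
    rw [a1, Pi.mul_apply]
    refine (mul_le_mul_of_nonneg_left a2 (Real.exp_pos _).le).trans_eq ?_
    rw [← Real.exp_add]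
    ring_nf
  have hVi := hVb.integrable Pr
  have hM1 : Pr[V | m] ≤ᵐ[Pr] fun _ => Real.exp c :=
    (condExp_mono hVi (hVe.integrable Pr) (.of_forall fun ω => by
      have := Real.add_one_le_exp (V ω)
      dsimp only
      linarith)).trans hE1
  have hM2 : Pr[-V | m] ≤ᵐ[Pr] fun _ => Real.exp c :=
    (condExp_mono hVi.neg (hVe'.integrable Pr) (.of_forall fun ω => by
      have := Real.add_one_le_exp (-V ω)
      simp only [Pi.neg_apply]
      linarith)).trans hE2
  have hVY : Pr[V | m] =ᵐ[Pr] fun ω => θ * (Pr[Y | m]) ω - Z ω := by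
    have e : V = θ • Y - Z := rfl
    have hZc : Pr[Z | m] = Z :=
      condExp_of_stronglyMeasurable hm hZm.stronglyMeasurable (hZ.integrable Pr)
    rw [e]
    filter_upwards [condExp_sub ((hY.integrable Pr).smul θ) (hZ.integrable Pr) m,
      condExp_smul (μ := Pr) θ Y m] with ω a1 a2
    rw [a1, Pi.sub_apply, a2, hZc]
    rfl
  set k : ℝ := Real.exp (-(θ * b) + Real.exp c) with hk
  have hG : BddMeas fun ω => k * (Real.exp (V ω) + Real.exp (-V ω)) :=
    (hVe.add hVe').const_mul k
  have hset : MeasurableSet {ω | |Y ω - (Pr[Y | m]) ω| > b} :=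
    measurableSet_lt measurable_const
      (hY.1.sub (stronglyMeasurable_condExp.mono hm).measurable).abs
  have hle : Set.indicator {ω | |Y ω - (Pr[Y | m]) ω| > b} (fun _ => (1 : ℝ)) ≤ᵐ[Pr]
      fun ω => k * (Real.exp (V ω) + Real.exp (-V ω)) := by
    filter_upwards [hM1, hM2, hVY, condExp_neg V m (μ := Pr)] with ω a1 a2 a3 a4
    rw [a4, Pi.neg_apply] at a2
    have hp1 := Real.exp_pos (V ω)
    have hp2 := Real.exp_pos (-V ω)
    refine Set.indicator_apply_le' (fun hω => ?_)
      fun _ => mul_nonneg (Real.exp_pos _).le (by positivity)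
    have hω' : b < |Y ω - (Pr[Y | m]) ω| := hω
    have hd : θ * b < |V ω - (Pr[V | m]) ω| := by
      rw [a3]
      simp only [hV]
      rw [show θ * Y ω - Z ω - (θ * (Pr[Y | m]) ω - Z ω) = θ * (Y ω - (Pr[Y | m]) ω) by ring,
        abs_mul, abs_of_pos hθ]
      exact mul_lt_mul_of_pos_left hω' hθ
    rw [mul_add, hk, ← Real.exp_add, ← Real.exp_add]
    rcases lt_abs.1 hd with hd | hd
    · have : 1 ≤ Real.exp (-(θ * b) + Real.exp c + V ω) := Real.one_le_exp (by linarith)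
      have := Real.exp_pos (-(θ * b) + Real.exp c + -V ω)
      linarith
    · have : 1 ≤ Real.exp (-(θ * b) + Real.exp c + -V ω) := Real.one_le_exp (by linarith)
      have := Real.exp_pos (-(θ * b) + Real.exp c + V ω)
      linarith
  have hcond : Pr[fun ω => k * (Real.exp (V ω) + Real.exp (-V ω)) | m] ≤ᵐ[Pr]
      fun _ => k * (Real.exp c + Real.exp c) := by
    have e : (fun ω => k * (Real.exp (V ω) + Real.exp (-V ω))) =
      k • ((fun ω => Real.exp (V ω)) + fun ω => Real.exp (-V ω)) := rfl
    rw [e]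
    filter_upwards [condExp_smul (μ := Pr) k
      ((fun ω => Real.exp (V ω)) + fun ω => Real.exp (-V ω)) m,
      condExp_add (hVe.integrable Pr) (hVe'.integrable Pr) m, hE1, hE2] with ω a1 a2 a3 a4
    rw [a1, Pi.smul_apply, a2, Pi.add_apply, smul_eq_mul]
    exact mul_le_mul_of_nonneg_left (add_le_add a3 a4) (Real.exp_pos _).le
  refine (condExp_mono ((integrable_const 1).indicator hset) (hG.integrable Pr) hle).trans
    (hcond.trans (.of_forall fun ω => le_of_eq ?_))
  rw [hk, Real.exp_add]
  ring

theorem sum_range_sum_gen (p : ℕ) (a : ℕ → Word → ℝ) :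
    ∑ ℓ ∈ Finset.range (p + 1), ∑ j ∈ gen (p - ℓ), a ℓ j = ∑ j ∈ tree p, a (p - j.length) j := by
  rw [tree, Finset.sum_biUnion]
  · rw [← Finset.sum_range_reflect]
    refine Finset.sum_congr rfl fun k hk => ?_
    have hk' : k < p + 1 := Finset.mem_range.1 hk
    rw [show p - (p + 1 - 1 - k) = k by omega]
    refine Finset.sum_congr rfl fun j hj => ?_
    rw [mem_gen.1 hj]
    rfl
  · intro k _ l _ hkl
    rw [Function.onFun, Finset.disjoint_left]
    intro u hu hu'
    exact hkl ((mem_gen.1 hu).symm.trans (mem_gen.1 hu'))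

theorem condExp_indicator_Dni_le {P : Kernel (Fin d → ℝ) ((Fin d → ℝ) × (Fin d → ℝ))}
    [IsMarkovKernel P] {Ω : Type*} [MeasurableSpace Ω] {Pr : Measure Ω} [IsProbabilityMeasure Pr]
    {X : Word → Ω → (Fin d → ℝ)} {ν : Measure (Fin d → ℝ)} (h : IsBMC Pr X ν P)
    {μm : Measure (Fin d → ℝ)} {f : ℕ → ℕ → (Fin d → ℝ) → ℝ} (p : ℕ → ℕ) (n : ℕ)
    (hf : ∀ k, BddMeas (f n k)) {α B C θ c : ℝ} (b : ℝ) (hα0 : 0 ≤ α) (hα : α < 1) (hC0 : 0 ≤ C)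
    (hB : ∀ r ≤ p n, ∀ x, |subtreeMean P μm (f n) r x| ≤ B)
    (hC : ∀ r ≤ p n, ∀ x, Qop P (fun y => subtreeMean P μm (f n) r y ^ 2) x ≤ C * (2 * α) ^ r)
    (hθ : 0 < θ) (hθB : θ * (4 * B) ≤ Real.sqrt (2 ^ n))
    (hc : θ ^ 2 * (2 * C / (1 - α)) * (2 ^ p n / 2 ^ n) ≤ c) (i : Word) :
    Pr[Set.indicator {ω' | |Dni Pr X μm f p n i ω'| > b} (fun _ => (1 : ℝ)) | Fsig X i]
      ≤ᵐ[Pr] fun _ => 2 * Real.exp c * Real.exp (Real.exp c) * Real.exp (-(θ * b)) := by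
  have hs : 0 < Real.sqrt (2 ^ n) := Real.sqrt_pos.2 (by positivity)
  have hg : ∀ k, BddMeas (tilde μm (f n k)) := fun k => (hf k).sub_const _
  have hmean : ∀ k, BddMeas (subtreeMean P μm (f n) k) := fun k => .subtreeMean hf k
  set t : ℝ := θ * (Real.sqrt (2 ^ n))⁻¹ with ht
  have ht0 : 0 < t := mul_pos hθ (inv_pos.2 hs)
  have htB : |t| * (4 * B) ≤ 1 := by
    rw [abs_of_pos ht0, ht, mul_right_comm, ← div_eq_mul_inv, div_le_one hs]
    exact hθB
  have hY : BddMeas (Nni X μm f p n i) :=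
    (BddMeas.sum _ fun ℓ _ => .sum _ fun j _ => (hg ℓ).comp (h.meas (i ++ j))).const_mul _
  have hexp : ∀ τ : ℝ, |τ| = t →
      Pr[fun ω => Real.exp (τ * Real.sqrt (2 ^ n) * Nni X μm f p n i ω) | Fsig X i] ≤ᵐ[Pr]
        fun ω => Real.exp (τ * subtreeMean P μm (f n) (p n) (X i ω) + c) := by
    intro τ hτ
    have e : (fun ω => Real.exp (τ * Real.sqrt (2 ^ n) * Nni X μm f p n i ω)) =
        fun ω => ∏ j ∈ tree (p n), Real.exp (τ * tilde μm (f n (p n - j.length)) (X (i ++ j) ω)) := by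
      funext ω
      rw [← Real.exp_sum, ← Finset.mul_sum, Nni,
        sum_range_sum_gen (p n) fun ℓ j => tilde μm (f n ℓ) (X (i ++ j) ω)]
      congr 1
      field_simp
    rw [e]
    filter_upwards [condExp_prod_subtree h (p n) i (fun k => ((hg k).const_mul τ).exp)] with ω hω
    rw [hω]
    refine (subtreeVal_exp_le hg (fun k => (hmean k).1) (subtreeMean_zero P μm (f n))
      (fun r x => subtreeMean_succ hf r x) hα hB hC (by rwa [hτ, ← abs_of_pos ht0]) (p n) le_rfl
      (X i ω)).2.trans ?_
    refine Real.exp_le_exp.2 (add_le_add le_rfl (le_trans ?_ hc))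
    have h1 : τ ^ 2 = θ ^ 2 / 2 ^ n := by
      rw [← sq_abs, hτ, ht, mul_pow, inv_pow, Real.sq_sqrt (by positivity), div_eq_mul_inv]
    have h2 : 0 ≤ α ^ p n := pow_nonneg hα0 _
    have h3 : 0 ≤ θ ^ 2 * (2 * C / (1 - α)) * (2 ^ p n / 2 ^ n) :=
      mul_nonneg (mul_nonneg (sq_nonneg _) (div_nonneg (by linarith) (by linarith)))
        (by positivity)
    rw [h1]
    calc θ ^ 2 / 2 ^ n * (2 * C / (1 - α) * 2 ^ p n * (1 - α ^ p n))
        = θ ^ 2 * (2 * C / (1 - α)) * (2 ^ p n / 2 ^ n) * (1 - α ^ p n) := by ring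
      _ ≤ _ := mul_le_of_le_one_right h3 (by linarith)
  have hts : t * Real.sqrt (2 ^ n) = θ := by
    rw [ht]
    field_simp
  refine condExp_deviation_le (Fsig_le h.meas i) hY
    (((hmean (p n)).comp (h.meas i)).const_mul t)
    (((hmean (p n)).1.comp (measurable_Fsig i)).const_mul t) hθ ?_ ?_
  · have := hexp t (abs_of_pos ht0)
    rwa [hts] at this
  · have := hexp (-t) (by rw [abs_neg, abs_of_pos ht0])
    simpa only [neg_mul, hts] using this

theorem exists_rate {P : Kernel (Fin d → ℝ) ((Fin d → ℝ) × (Fin d → ℝ))}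
    {μm : Measure (Fin d → ℝ)} {M α γ : ℝ} (hM : 0 ≤ M) (hα0 : 0 < α) (hα1 : α < 1)
    (herg : ErgodicQ P μm M α) (hγ : 0 < γ) (hd : 1 ≤ d)
    (hα2 : 1 / 2 < α →
      Tendsto (fun n : ℕ => ((2 : ℝ) ^ (1 - (d : ℝ) * γ) * α) ^ n) atTop (nhds 0)) :
    ∃ α' : ℝ, 1 / 2 < α' ∧ α' < 1 ∧ ErgodicQ P μm M α' ∧ (2 : ℝ) ^ (1 - (d : ℝ) * γ) * α' ≤ 1 := by
  by_cases h : 1 / 2 < α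
  · refine ⟨α, h, hα1, herg, ?_⟩
    have := tendsto_pow_atTop_nhds_zero_iff.1 (hα2 h)
    exact (le_abs_self _).trans this.le
  · have hd0 : (0 : ℝ) < d := by exact_mod_cast hd
    have hdγ : 0 < (d : ℝ) * γ := mul_pos hd0 hγ
    have hlt : (1 : ℝ) / 2 < (2 : ℝ) ^ ((d : ℝ) * γ - 1) := by
      rw [show (1 : ℝ) / 2 = (2 : ℝ) ^ (-1 : ℝ) by rw [Real.rpow_neg_one]; norm_num]
      exact Real.rpow_lt_rpow_of_exponent_lt one_lt_two (by linarith)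
    set β : ℝ := min (3 / 4) ((2 : ℝ) ^ ((d : ℝ) * γ - 1)) with hβ
    have hβ1 : 1 / 2 < β := lt_min (by norm_num) hlt
    refine ⟨β, hβ1, (min_le_left _ _).trans_lt (by norm_num), ?_, ?_⟩
    · intro f C hf hC n x
      have hC0 : 0 ≤ C := (abs_nonneg _).trans (hC x)
      refine (herg f C hf hC n x).trans ?_
      have : α ≤ β := by linarith
      gcongr
    · calc (2 : ℝ) ^ (1 - (d : ℝ) * γ) * β
          ≤ (2 : ℝ) ^ (1 - (d : ℝ) * γ) * (2 : ℝ) ^ ((d : ℝ) * γ - 1) :=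
            mul_le_mul_of_nonneg_left (min_le_right _ _) (by positivity)
        _ = 1 := by
          rw [← Real.rpow_add two_pos]
          simp

theorem eventually_rate_le {b η : ℕ → ℝ} (hb : Tendsto b atTop atTop) (hη : ∀ n, 0 < η n)
    (h : Tendsto (fun n : ℕ => (n : ℝ) ^ (3 / 2 : ℝ) * b n / Real.sqrt (2 ^ n * η n ^ 2))
      atTop (nhds 0)) {A K : ℝ} (hA : 0 ≤ A) (hK : 0 ≤ K) :
    ∀ᶠ n : ℕ in atTop, (A * b n + n) * K ≤ Real.sqrt (2 ^ n) * η n := by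
  have hε : (0 : ℝ) < 1 / ((A + 1) * K + 1) := by positivity
  filter_upwards [h.eventually_le_const hε, hb.eventually_ge_atTop 1, eventually_ge_atTop 1]
    with n h1 h2 h3
  have hn : (1 : ℝ) ≤ n := by exact_mod_cast h3
  have hs : 0 < Real.sqrt (2 ^ n) * η n := mul_pos (Real.sqrt_pos.2 (by positivity)) (hη n)
  rw [Real.sqrt_mul (by positivity), Real.sqrt_sq (hη n).le, div_le_div_iff₀ hs (by positivity),
    one_mul] at h1
  have hpow : (n : ℝ) ≤ (n : ℝ) ^ (3 / 2 : ℝ) := by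
    simpa using Real.rpow_le_rpow_of_exponent_le hn (by norm_num : (1 : ℝ) ≤ 3 / 2)
  set N : ℝ := (n : ℝ) ^ (3 / 2 : ℝ)
  have e1 : A * b n + n ≤ (A + 1) * (N * b n) := by
    have : b n ≤ N * b n := le_mul_of_one_le_left (by linarith) (by linarith)
    have : (n : ℝ) ≤ N * b n := hpow.trans (le_mul_of_one_le_right (by linarith) h2)
    nlinarith
  have e2 := mul_le_mul_of_nonneg_right e1 hK
  have e3 : 0 ≤ N * b n := mul_nonneg (by linarith) (by linarith)
  nlinarith

theorem sq_le_two_mul_two_pow (q : ℕ) : (q : ℝ) ^ 2 ≤ 2 * 2 ^ q := by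
  have h : q ^ 2 ≤ 2 * 2 ^ q := by
    induction q with
    | zero => simp
    | succ q ih =>
      rcases lt_or_ge q 3 with hq | hq
      · interval_cases q <;> norm_num
      · rw [pow_succ 2 q]
        nlinarith
  exact_mod_cast h

theorem eventually_variance_le {b : ℕ → ℝ} {p : ℕ → ℕ} (hb : Tendsto b atTop atTop)
    (hp1 : ∀ n, 1 ≤ p n) (hpn : ∀ n, 1 ≤ n → p n ≤ n)
    (h : Tendsto (fun n => (p n : ℝ) ^ 3 * b n ^ 2 / 2 ^ (n - p n : ℕ)) atTop (nhds 0)) (A : ℝ) :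
    ∀ᶠ n : ℕ in atTop, (A * b n + n) ^ 2 * (2 ^ p n / 2 ^ n) ≤ 14 := by
  have hε : (0 : ℝ) < 1 / (A ^ 2 + 1) := by positivity
  filter_upwards [h.eventually_le_const hε, hb.eventually_ge_atTop 1, eventually_ge_atTop 1]
    with n h1 h2 h3
  obtain ⟨q, hq⟩ := Nat.exists_eq_add_of_le (hpn n h3)
  have hp : (1 : ℝ) ≤ p n := by exact_mod_cast hp1 n
  have hn : (n : ℝ) = p n + q := by exact_mod_cast hq
  have hpow : (2 : ℝ) ^ n = 2 ^ p n * 2 ^ q := by rw [← pow_add, ← hq]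
  have hQ : (0 : ℝ) < 2 ^ q := by positivity
  rw [show n - p n = q by omega, div_le_div_iff₀ hQ (by positivity), one_mul] at h1
  have hq2 := sq_le_two_mul_two_pow q
  set Q : ℝ := 2 ^ q
  have e0 : (2 : ℝ) ^ p n / 2 ^ n = 1 / Q := by
    rw [hpow]
    field_simp
  rw [e0, mul_one_div, div_le_iff₀ hQ, hn]
  have hb2 : 1 ≤ b n ^ 2 := one_le_pow₀ h2
  have hp3 : (p n : ℝ) ^ 2 ≤ (p n : ℝ) ^ 3 := pow_le_pow_right₀ hp (by norm_num)
  have hp3' : 1 ≤ (p n : ℝ) ^ 3 := one_le_pow₀ hp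
  set R : ℝ := (p n : ℝ) ^ 3 * b n ^ 2
  have e1 : (p n : ℝ) ^ 2 ≤ R := hp3.trans (le_mul_of_one_le_right (by linarith) hb2)
  have e2 : b n ^ 2 ≤ R := le_mul_of_one_le_left (by positivity) hp3'
  have e3 : A ^ 2 * b n ^ 2 ≤ A ^ 2 * R := mul_le_mul_of_nonneg_left e2 (sq_nonneg A)
  have e4 : 0 ≤ R := by positivity
  have e5 : 0 ≤ A ^ 2 * R := by positivity
  nlinarith [sq_nonneg (A * b n - (p n + q)), sq_nonneg ((p n : ℝ) - q)]

/-- Lemma 5.9: Chen–Ledoux type condition. -/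
theorem chen_ledoux_condition
    {d : ℕ} (hd : 1 ≤ d)
    {Ω : Type*} [MeasurableSpace Ω] (Pr : Measure Ω) [IsProbabilityMeasure Pr]
    (X : Word → Ω → (Fin d → ℝ)) (ν : Measure (Fin d → ℝ)) [IsProbabilityMeasure ν]
    (P : Kernel (Fin d → ℝ) ((Fin d → ℝ) × (Fin d → ℝ))) [IsMarkovKernel P]
    (hBMC : IsBMC Pr X ν P)
    (μm : Measure (Fin d → ℝ)) [IsProbabilityMeasure μm] (hinv : IsInvariantQ P μm)
    (M α : ℝ) (hM : 0 < M) (hα0 : 0 < α) (hα1 : α < 1) (herg : ErgodicQ P μm M α)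
    (γ : ℝ) (hγ0 : 0 < γ) (hγd : γ < 1 / (d : ℝ))
    (f : ℕ → ℕ → (Fin d → ℝ) → ℝ) (σ2 : ℝ) (hf : FnAssump P μm γ f σ2)
    (hα2 : 1 / 2 < α →
      Tendsto (fun n : ℕ => ((2 : ℝ) ^ (1 - (d : ℝ) * γ) * α) ^ n) atTop (nhds 0))
    (s : ℝ) (hs : 0 < s) (b : ℕ → ℝ) (hb : SpeedCond b γ s d)
    (p : ℕ → ℕ) (hp : PCond p b) :
    Filter.limsup
      (fun n => (((b n ^ 2)⁻¹ : ℝ) : EReal) *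
        ENNReal.log ((2 : ENNReal) ^ n *
          ⨆ i ∈ gen (n - p n),
            essSup (fun ω => ENNReal.ofReal
              ((Pr[Set.indicator {ω' | |Dni Pr X μm f p n i ω'| > b n} (fun _ => (1 : ℝ))
                | Fsig X i]) ω)) Pr))
      atTop = ⊥ := by
  obtain ⟨α', hα'1, hα'2, herg', hα'3⟩ := exists_rate hM.le hα0 hα1 herg hγ0 hd hα2
  obtain ⟨hfm, hf0, ⟨C₁, hC₁⟩, ⟨C₂, hC₂⟩, -⟩ := hf
  obtain ⟨hb0, hbt, hb1, -⟩ := hb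
  obtain ⟨-, hp1, hpn, hpt⟩ := hp
  set C : ℝ := max C₁ C₂ with hCdef
  set η : ℕ → ℝ := fun n => bandwidth γ n ^ ((d : ℝ) / 2) with hη
  have hh0 : ∀ n, 0 < bandwidth γ n := fun n => Real.rpow_pos_of_pos two_pos _
  have hη0 : ∀ n, 0 < η n := fun n => Real.rpow_pos_of_pos (hh0 n) _
  have hη1 : ∀ n, η n ≤ 1 := fun n => by
    refine Real.rpow_le_one (hh0 n).le ?_ (by positivity)
    refine Real.rpow_le_one_of_one_le_of_nonpos one_le_two ?_
    have : 0 ≤ (n : ℝ) * γ := by positivity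
    linarith
  have hη2 : ∀ n, bandwidth γ n ^ (d : ℝ) = η n ^ 2 := fun n => by
    simp only [hη]
    rw [← Real.rpow_natCast, ← Real.rpow_mul (hh0 n).le]
    norm_num
  have hηpow : ∀ n, η n ^ 2 = ((2 : ℝ) ^ (-((d : ℝ) * γ))) ^ n := fun n => by
    rw [← hη2, bandwidth, ← Real.rpow_mul zero_le_two, ← Real.rpow_natCast,
      ← Real.rpow_mul zero_le_two]
    ring_nf
  have hbm : ∀ n k, BddMeas (f n k) := by
    intro n k
    by_cases hk : k ≤ n
    · refine ⟨hfm n k, C₁ / η n, fun x => ?_⟩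
      rw [le_div_iff₀ (hη0 n), mul_comm]
      exact (hC₁ n k hk).1 x
    · rw [hf0 n k (not_le.1 hk)]
      exact .const 0
  have hbounds : ∀ n, 1 ≤ n → ∀ r ≤ p n, _ := fun n hn r hr =>
    subtreeMean_bounds (p := p n) (η := η n) (C := C) hinv hM.le hα'1 herg' (hbm n) (hη0 n) (hη1 n)
      (by
        refine (mul_le_mul_of_nonneg_right (pow_le_pow_right₀ (by linarith) (hpn n hn))
          (sq_nonneg _)).trans ?_
        rw [hηpow, ← mul_pow]
        refine pow_le_one₀ (by positivity) ?_
        rw [sub_eq_add_neg, Real.rpow_add two_pos, Real.rpow_one] at hα'3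
        linarith)
      (fun ℓ hℓ x => ((hC₁ n ℓ (hℓ.trans (hpn n hn))).1 x).trans (le_max_left _ _))
      (fun ℓ hℓ x => ((hC₁ n ℓ (hℓ.trans (hpn n hn))).2.1 x).trans
        (mul_le_mul_of_nonneg_right (le_max_left _ _) (hη0 n).le))
      (fun ℓ hℓ x => ((hC₁ n ℓ (hℓ.trans (hpn n hn))).2.2.1 x).trans (le_max_left _ _))
      (fun ℓ hℓ => ((hC₂ n ℓ (hℓ.trans (hpn n hn))).1).trans
        (mul_le_mul_of_nonneg_right (le_max_right _ _) (hη0 n).le)) r hr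
  have hC0 : 0 ≤ C := (mul_nonneg (hη0 0).le (abs_nonneg _)).trans
    (((hC₁ 0 0 le_rfl).1 0).trans (le_max_left _ _))
  set B : ℝ := 2 * C + 2 * M * C / (2 * α' - 1) with hB
  set V : ℝ := 4 * C + 4 * C ^ 2 + 2 * (2 * M * C / (2 * α' - 1)) ^ 2 with hV
  have hB0 : 0 ≤ B := add_nonneg (by positivity) (div_nonneg (by positivity) (by linarith))
  have hV0 : 0 ≤ V := by positivity
  set D : ℝ := 2 * V / (1 - α') with hD
  have hD0 : 0 ≤ D := div_nonneg (by linarith) (by linarith)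
  set K : ℝ := 2 * Real.exp (14 * D) * Real.exp (Real.exp (14 * D)) with hK
  have hK0 : 0 < K := by positivity
  rw [EReal.eq_bot_iff_forall_lt]
  intro y
  set A : ℝ := |Real.log K| + |y| + 1 with hA
  have hA0 : 0 ≤ A := by positivity
  refine lt_of_le_of_lt (b := ((y - 1 : ℝ) : EReal)) ?_ (by exact_mod_cast sub_one_lt y)
  refine limsup_le_of_le (by isBoundedDefault) ?_
  filter_upwards [eventually_rate_le hbt (hη0 ·) (by simpa only [hη2] using hb1) hA0
      (by positivity : 0 ≤ 4 * B),
    eventually_variance_le hbt hp1 hpn hpt A, hbt.eventually_ge_atTop 1, eventually_ge_atTop 1]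
    with n h1 h2 hbn hn
  have hθ : 0 < A * b n + n := add_pos_of_nonneg_of_pos (mul_nonneg hA0 (by linarith))
    (by exact_mod_cast hn)
  have htail := condExp_indicator_Dni_le (Pr := Pr) (θ := A * b n + n) (c := 14 * D) hBMC p n
    (hbm n) (b n) (by linarith) hα'2 hV0 (fun r hr => (hbounds n hn r hr).1)
    (fun r hr => (hbounds n hn r hr).2) hθ
    (by
      rw [← mul_div_assoc, ← mul_div_assoc, div_le_iff₀ (hη0 n)]
      exact h1)
    (by
      rw [mul_right_comm]
      exact mul_le_mul_of_nonneg_right h2 hD0)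
  have hsup : (⨆ i ∈ gen (n - p n), essSup (fun ω => ENNReal.ofReal
      ((Pr[Set.indicator {ω' | |Dni Pr X μm f p n i ω'| > b n} (fun _ => (1 : ℝ))
        | Fsig X i]) ω)) Pr) ≤ ENNReal.ofReal (K * Real.exp (-((A * b n + n) * b n))) := by
    refine iSup₂_le fun i _ => essSup_le_of_ae_le _ ?_
    filter_upwards [htail i] with ω hω
    exact ENNReal.ofReal_le_ofReal hω
  have hpos : 0 < 2 ^ n * (K * Real.exp (-((A * b n + n) * b n))) := by positivity
  have hlog : ENNReal.log ((2 : ENNReal) ^ n * ⨆ i ∈ gen (n - p n), essSup (fun ω =>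
      ENNReal.ofReal ((Pr[Set.indicator {ω' | |Dni Pr X μm f p n i ω'| > b n} (fun _ => (1 : ℝ))
        | Fsig X i]) ω)) Pr) ≤
      ((Real.log (2 ^ n * (K * Real.exp (-((A * b n + n) * b n)))) : ℝ) : EReal) := by
    rw [← ENNReal.log_ofReal_of_pos hpos]
    refine ENNReal.log_monotone ?_
    rw [ENNReal.ofReal_mul (by positivity), ENNReal.ofReal_pow zero_le_two, ENNReal.ofReal_ofNat]
    gcongr
  refine (mul_le_mul_of_nonneg_left hlog (by positivity)).trans ?_
  rw [← EReal.coe_mul, EReal.coe_le_coe_iff, Real.log_mul (by positivity) (by positivity),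
    Real.log_mul hK0.ne' (Real.exp_pos _).ne', Real.log_exp, Real.log_pow,
    inv_mul_le_iff₀ (by positivity)]
  have hl2 : Real.log 2 ≤ 1 := Real.log_two_lt_d9.le.trans (by norm_num)
  have hn0 : (0 : ℝ) ≤ n := n.cast_nonneg
  have hbb : 1 ≤ b n ^ 2 := one_le_pow₀ hbn
  have e1 : (n : ℝ) * Real.log 2 ≤ n * b n := mul_le_mul_of_nonneg_left (hl2.trans hbn) hn0
  have e2 : Real.log K ≤ b n ^ 2 * |Real.log K| :=
    (le_abs_self _).trans (le_mul_of_one_le_left (abs_nonneg _) hbb)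
  have e3 : -(b n ^ 2 * |y|) ≤ b n ^ 2 * y := by
    rw [← mul_neg]
    exact mul_le_mul_of_nonneg_left (neg_abs_le y) (by positivity)
  have e4 : (A * b n + n) * b n =
      b n ^ 2 * |Real.log K| + b n ^ 2 * |y| + b n ^ 2 + n * b n := by
    rw [hA]
    ring
  rw [e4, mul_sub, mul_one]
  linarith

end BMC
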